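/- The ℚ-vector space MPV(4,4) spanned by all multiple polylogarithm values of weight 4 and level 4 has dimension at most 16, i.e., d(4,4) ≤ 16. -/

import Mathlib

open Filter Topology

/-- `mpvPartial l m` is the finite iterated sum
`∑_{m > k₁ > k₂ > ⋯ > kₙ > 0} ∏ⱼ ζⱼ^{kⱼ} / kⱼ^{sⱼ}`, where `l = [(s₁,ζ₁),…,(sₙ,ζₙ)]`,
i.e. the partial sum (in the outermost variable `k₁`) of the multiple
polylogarithm series; the inner sums are finite. -/
noncomputable def mpvPartial : List (ℕ × ℂ) → ℕ → ℂ
  | [], _ => 1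
  | (s, z) :: t, m => ∑ k ∈ Finset.Ico 1 m, z ^ k / (k : ℂ) ^ s * mpvPartial t k

/-- The multiple polylogarithm value
`Li_{s₁,…,sₙ}(ζ₁,…,ζₙ) = ∑_{k₁>⋯>kₙ>0} ζ₁^{k₁}⋯ζₙ^{kₙ} / (k₁^{s₁}⋯kₙ^{sₙ})`,
encoded by the list `l = [(s₁,ζ₁),…,(sₙ,ζₙ)]`: the limit of the sequence of
partial sums in the outermost summation variable. -/
noncomputable def Li (l : List (ℕ × ℂ)) : ℂ :=
  limUnder atTop (mpvPartial l)

/-- The set of all multiple polylogarithm values of weight `w` and level `N`: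
values `Li_{s₁,…,sₙ}(ζ₁,…,ζₙ)` with all `sⱼ ≥ 1`, all `ζⱼ` being `N`-th roots of
unity, total weight `s₁+⋯+sₙ = w`, and `(s₁,ζ₁) ≠ (1,1)`. -/
def MPVset (w N : ℕ) : Set ℂ :=
  {x | ∃ l : List (ℕ × ℂ),
    (∀ q ∈ l, 0 < q.1 ∧ q.2 ^ N = 1) ∧
    (l.map Prod.fst).sum = w ∧
    l.head? ≠ some (1, 1) ∧
    x = Li l}

/-- `MPV w N` is the `ℚ`-vector subspace of `ℂ` spanned by all multiple
polylogarithm values of weight `w` and level `N`. -/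
noncomputable def MPV (w N : ℕ) : Submodule ℚ ℂ :=
  Submodule.span ℚ (MPVset w N)

namespace Polylog
noncomputable section

/-- The quasi-shuffles of two words, listed with multiplicity: two letters `a`, `b` may be
interleaved in either order, or merged into any of the letters in `mul a b`. -/
def quasiShuffle {α : Type*} (mul : α → α → List α) : List α → List α → List (List α)
  | [], v => [v]
  | a :: u, v => go a u (quasiShuffle mul u) v
where
  go (a : α) (u : List α) (f : List α → List (List α)) : List α → List (List α)
  | [] => [a :: u]
  | b :: v => (f (b :: v)).map (a :: ·) ++ (go a u f v).map (b :: ·) ++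
      (mul a b).flatMap fun c => (f v).map (c :: ·)

def shuffle (u v : List ℕ) : List (List ℕ) := quasiShuffle (fun _ _ => []) u v

def stuffle (u v : List (ℕ × ℕ)) : List (List (ℕ × ℕ)) :=
  quasiShuffle (fun p q => [(p.1 + q.1, p.2 + q.2)]) u v

def normExp (e : ℕ) : ℕ := (e + 3) % 4 + 1

def rotate (e a : ℕ) : ℕ := if a = 0 then 0 else normExp (e + a)

def toWord : List (ℕ × ℕ) → List ℕ
  | [] => []
  | (s, e) :: t => List.replicate (s - 1) 0 ++ normExp e :: (toWord t).map (rotate e)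

def dualLetter : ℕ → List (ℤ × ℕ)
  | 0 => [(1, 4), (-1, 2)]
  | 1 => [(1, 2), (-1, 3)]
  | 2 => [(1, 2)]
  | 3 => [(1, 2), (-1, 1)]
  | 4 => [(1, 0), (1, 2)]
  | _ => []

def dualTerms : List ℕ → List (ℤ × List ℕ)
  | [] => [(1, [])]
  | a :: r => (dualLetter a).flatMap fun p =>
      (dualTerms r).map fun q => (p.1 * q.1, p.2 :: q.2)

/-- The words whose power series has no logarithmic singularity at `0`. -/
def Good : List ℕ → Bool
  | [] => true
  | a :: w => Nat.blt a 5 && (Nat.blt 0 a || !w.isEmpty) && Good w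

/-- The words whose iterated integral from `0` to `1` converges. -/
def Conv (w : List ℕ) : Bool := w.head? != some 4 && Good w

/-- The index of a multiple polylogarithm whose iterated integral has the given word. -/
def toIndex (prev s : ℕ) : List ℕ → List (ℕ × ℕ)
  | [] => []
  | 0 :: w => toIndex prev (s + 1) w
  | a :: w => (s, a + 3 * prev) :: toIndex a 1 w

def shuffleTerms (l : List (ℤ × List ℕ)) (w : List ℕ) : List (ℤ × List ℕ) :=
  l.flatMap fun q => (shuffle q.2 w).map fun v => (q.1, v)

/-- The word whose letters are the decimal digits of `n` modulo `5`. -/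
def dec : ℕ → ℕ → List ℕ → List ℕ
  | 0, _, acc => acc
  | f + 1, n, acc => if n = 0 then acc else dec f (n / 10) (n % 10 % 5 :: acc)

/-- The duality relation, distribution relation or double shuffle relation with code `(u, v)`. -/
def terms (u v : ℕ) : List (ℤ × List ℕ) :=
  let w := dec 5 v []
  match u with
  | 0 => (1, w) :: (dualTerms w.reverse).map fun q => (-q.1, q.2)
  | 6 => bif Conv w then shuffleTerms [(1, [1]), (1, [3]), (-1, [2])] w else []
  | 7 => bif Conv w then shuffleTerms [(2, [0, 1]), (2, [0, 3]), (-1, [0, 2])] w else []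
  | u =>
    let p := toIndex 0 1 (dec 5 u [])
    let q := toIndex 0 1 w
    bif Conv (toWord p) && Conv (toWord q) then
      (shuffle (toWord p) (toWord q)).map (fun x => (1, x)) ++
      (stuffle p q).map (fun x => (-1, toWord x))
    else []

theorem Good.cons {a : ℕ} {w : List ℕ} (h : Good (a :: w)) :
    a < 5 ∧ (0 < a ∨ w ≠ []) ∧ Good w := by
  simpa [Good, and_assoc] using h

theorem Conv.good {w : List ℕ} (h : Conv w) : Good w := by
  rw [Conv, Bool.and_eq_true] at h
  exact h.2

section PackedVectors

/-! Vectors over `ZMod 7` are packed into natural numbers: the entries are the base-64 digits,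
each of them at most `7`. All operations are designed to be evaluated by the kernel. -/

/-- `f n`, with `n` evaluated to a numeral first -/
def force {α : Type*} (n : ℕ) (f : ℕ → α) : α :=
  Nat.rec (f 0) (fun n _ => f (Nat.succ n)) n

theorem force_eq {α : Type*} (n : ℕ) (f : ℕ → α) : force n f = f n := by
  cases n <;> rfl

/-- The number with `n` base-64 digits, all of them equal to `7`. -/
def sevens (n : ℕ) : ℕ := Nat.rec 0 (fun _ x => Nat.add (Nat.mul 64 x) 7) n

/-- Reduces the digits modulo `7`, incompletely. -/
def fold (M x : ℕ) : ℕ := Nat.add (Nat.land x M) (Nat.land (Nat.shiftRight x 3) M)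

/-- `d • a + b` -/
def addMul (M d a b : ℕ) : ℕ :=
  force (Nat.add (Nat.mul d a) b) fun x => force (fold M x) fun x => fold M x

def entry (x s : ℕ) : ℕ := Nat.land 7 (Nat.shiftRight x s)

/-- Eliminates the entry at the shift `s` of `x` by means of the vector `p`. -/
def step (M s p x : ℕ) : ℕ :=
  force x fun x => Nat.rec x (fun v _ => addMul M (Nat.sub 6 v) p x) (entry x s)

/-- A stack of vectors `p`, each with the shift `s` of its pivot. -/
inductive Pivots
  | nil
  | cons (s p : ℕ) (l : Pivots)

def Pivots.reduce (M x : ℕ) (l : Pivots) : ℕ :=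
  Pivots.rec x (fun s p _ x => step M s p x) l

def monic (M s x : ℕ) : ℕ :=
  addMul M (Nat.mod (Nat.pow (entry x s) 5) 7) x 0

/-- Back substitution: extends the set `K` of the digits at which the unknown is known to vanish. -/
def Pivots.known (M : ℕ) (l : Pivots) : ℕ → ℕ :=
  Pivots.rec (fun K => K) (fun s p _ ih K =>
    force (Nat.lor K (Nat.shiftLeft 7 s)) fun K' =>
    force (Nat.land p (Nat.xor K' M)) fun r =>
    Bool.rec (ih K) (ih K') (Bool.and (Nat.beq (entry p s) 1)
      (Nat.beq r (Nat.mul 7 (Nat.land (Nat.div r 7) M))))) l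

/-- The unit vector at `k + 10`. The first ten entries are pseudorandom: the kernel hashes a
numeral by its lowest 64 bits. -/
def unitRow (M k : ℕ) : ℕ :=
  Nat.add (Nat.shiftLeft 1 (Nat.mul 6 (Nat.add k 10)))
    (Nat.land (Nat.mod (Nat.mul (Nat.succ k) 11400714819323198485) (Nat.pow 64 10)) M)

def dig (x j : ℕ) : ℕ := x / 64 ^ j % 64

theorem dig_zero (x : ℕ) : dig x 0 = x % 64 := by simp [dig]

theorem dig_succ (x j : ℕ) : dig x (j + 1) = dig (x / 64) j := by
  simp [dig, pow_succ', Nat.div_div_eq_div_mul]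

theorem zero_dig (j : ℕ) : dig 0 j = 0 := by simp [dig]

theorem dig_add_mul {d a b : ℕ} (h : ∀ j, d * dig a j + dig b j < 64) (j : ℕ) :
    dig (d * a + b) j = d * dig a j + dig b j := by
  have hab : d * a + b = 64 * (d * (a / 64) + b / 64) + (d * (a % 64) + b % 64) := by
    nth_rw 1 [← Nat.div_add_mod a 64, ← Nat.div_add_mod b 64]
    ring
  have h0 := h 0
  simp only [dig_zero] at h0
  induction j generalizing a b with
  | zero =>
    simp only [dig_zero]
    omega
  | succ j ih =>
    have h1 := fun j => by simpa only [dig_succ] using h (j + 1)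
    have h2 := h1 0
    simp only [dig_zero] at h2
    rw [dig_succ, dig_succ, dig_succ, ← ih h1 _ h2]
    · congr 1
      omega
    · nth_rw 1 [← Nat.div_add_mod (a / 64) 64, ← Nat.div_add_mod (b / 64) 64]
      ring

theorem dig_land (a b j : ℕ) : dig (a &&& b) j = dig a j &&& dig b j := by
  refine Nat.eq_of_testBit_eq fun i => ?_
  have : (64 : ℕ) = 2 ^ 6 := rfl
  simp only [dig, this, ← pow_mul, Nat.testBit_mod_two_pow, Nat.testBit_div_two_pow,
    Nat.testBit_and]
  cases decide (i < 6) <;> simp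

theorem dig_lor (a b j : ℕ) : dig (a ||| b) j = dig a j ||| dig b j := by
  refine Nat.eq_of_testBit_eq fun i => ?_
  have : (64 : ℕ) = 2 ^ 6 := rfl
  simp only [dig, this, ← pow_mul, Nat.testBit_mod_two_pow, Nat.testBit_div_two_pow,
    Nat.testBit_or]
  cases decide (i < 6) <;> simp

theorem dig_xor (a b j : ℕ) : dig (a ^^^ b) j = dig a j ^^^ dig b j := by
  refine Nat.eq_of_testBit_eq fun i => ?_
  have : (64 : ℕ) = 2 ^ 6 := rfl
  simp only [dig, this, ← pow_mul, Nat.testBit_mod_two_pow, Nat.testBit_div_two_pow,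
    Nat.testBit_xor]
  cases decide (i < 6) <;> simp

theorem dig_sevens (n j : ℕ) : dig (sevens n) j = if j < n then 7 else 0 := by
  induction n generalizing j with
  | zero => simp [dig, sevens]
  | succ n ih =>
    have : sevens (n + 1) = 64 * sevens n + 7 := rfl
    cases j with
    | zero => rw [dig_zero]; simp; omega
    | succ j =>
      rw [dig_succ, this, show (64 * sevens n + 7) / 64 = sevens n by omega, ih]
      simp

theorem dig_mul_pow {c : ℕ} (hc : c < 64) (i j : ℕ) :
    dig (c * 64 ^ i) j = if j = i then c else 0 := by
  induction i generalizing j with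
  | zero =>
    cases j with
    | zero => simp [dig_zero, Nat.mod_eq_of_lt hc]
    | succ j => rw [dig_succ, pow_zero, mul_one, Nat.div_eq_of_lt hc, zero_dig, if_neg (by simp)]
  | succ i ih =>
    have : c * 64 ^ (i + 1) = 64 * (c * 64 ^ i) := by ring
    cases j with
    | zero => rw [dig_zero, this]; simp
    | succ j =>
      rw [dig_succ, this, Nat.mul_div_cancel_left _ (by norm_num), ih]
      simp

theorem dig_shiftLeft {c : ℕ} (hc : c < 64) (i j : ℕ) :
    dig (c <<< (6 * i)) j = if j = i then c else 0 := by
  rw [Nat.shiftLeft_eq, pow_mul, ← dig_mul_pow hc]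
  norm_num

theorem dig_eq_zero {x n j : ℕ} (hx : x < 64 ^ n) (hj : n ≤ j) : dig x j = 0 := by
  rw [dig, Nat.div_eq_of_lt (hx.trans_le (Nat.pow_le_pow_right (by norm_num) hj))]

theorem land_seven (x : ℕ) : x &&& 7 = x % 8 := Nat.and_two_pow_sub_one_eq_mod x 3

theorem dig_land_sevens (x n j : ℕ) : dig (x &&& sevens n) j = if j < n then dig x j % 8 else 0 := by
  rw [dig_land, dig_sevens]
  split_ifs <;> simp [land_seven]

theorem entry_eq (x j : ℕ) : entry x (6 * j) = dig x j % 8 := by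
  rw [entry]
  change 7 &&& (x >>> (6 * j)) = _
  rw [Nat.and_comm, land_seven, Nat.shiftRight_eq_div_pow, pow_mul, dig]
  norm_num

def SmallDigits (x : ℕ) : Prop := ∀ j, dig x j ≤ 7

theorem smallDigits_zero : SmallDigits 0 := fun j => by simp [zero_dig]

theorem dig_fold (n x j : ℕ) :
    dig (fold (sevens n) x) j = if j < n then dig x j % 8 + dig x j / 8 else 0 := by
  have key : ∀ j, dig (x >>> 3) j % 8 = dig x j / 8 := fun j => by
    rw [Nat.shiftRight_eq_div_pow, dig, dig, Nat.div_div_eq_div_mul, mul_comm,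
      ← Nat.div_div_eq_div_mul]
    omega
  have hlt : ∀ j, dig x j < 64 := fun j => Nat.mod_lt _ (by norm_num)
  change dig ((x &&& sevens n) + ((x >>> 3) &&& sevens n)) j = _
  have := dig_add_mul (d := 1) (a := x &&& sevens n) (b := (x >>> 3) &&& sevens n) (fun j => by
    simp only [dig_land_sevens, key]
    have := hlt j
    split_ifs <;> omega) j
  rw [one_mul, one_mul] at this
  rw [this]
  simp only [dig_land_sevens, key]
  split_ifs <;> rfl

variable {V : Type*} [AddCommGroup V]

/-- The pairing of a packed vector of length `n` with the vector `y`. -/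
def eval (n : ℕ) (y : ℕ → V) (x : ℕ) : V := ∑ j ∈ Finset.range n, dig x j • y j

theorem nsmul_eq_of_modEq {v : V} (hv : 7 • v = 0) {a b : ℕ} (h : a % 7 = b % 7) :
    a • v = b • v := by
  rw [← Nat.div_add_mod a 7, ← Nat.div_add_mod b 7, h, add_smul, add_smul, mul_comm 7, mul_comm 7,
    mul_smul, mul_smul, hv, smul_zero, smul_zero]

theorem addMul_spec {n d a b : ℕ} {y : ℕ → V} (hy : ∀ j, 7 • y j = 0) (hd : d ≤ 7) (ha : SmallDigits a)
    (hb : SmallDigits b) :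
    SmallDigits (addMul (sevens n) d a b) ∧
      eval n y (addMul (sevens n) d a b) = d • eval n y a + eval n y b := by
  have h : ∀ j, d * dig a j + dig b j < 64 := fun j => by
    have := Nat.mul_le_mul hd (ha j)
    have := hb j
    omega
  have key : ∀ j, dig (addMul (sevens n) d a b) j =
      if j < n then ((d * dig a j + dig b j) % 8 + (d * dig a j + dig b j) / 8) % 8 +
        ((d * dig a j + dig b j) % 8 + (d * dig a j + dig b j) / 8) / 8 else 0 := fun j => by
    rw [addMul, force_eq, force_eq, dig_fold, dig_fold]
    change (if j < n then (if j < n then dig (d * a + b) j % 8 + dig (d * a + b) j / 8 else _) % 8 +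
      (if j < n then dig (d * a + b) j % 8 + dig (d * a + b) j / 8 else _) / 8 else _) = _
    rw [dig_add_mul h]
    split_ifs <;> rfl
  refine ⟨fun j => ?_, ?_⟩
  · rw [key]
    have := h j
    split_ifs <;> omega
  · simp only [eval, Finset.smul_sum, ← Finset.sum_add_distrib]
    refine Finset.sum_congr rfl fun j hj => ?_
    rw [key, if_pos (Finset.mem_range.1 hj), ← mul_smul, ← add_smul]
    exact nsmul_eq_of_modEq (hy j) (by omega)

theorem unitRow_spec {n k : ℕ} {y : ℕ → V} (hy : ∀ j < 10, y j = 0) (hk : k + 10 < n) :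
    SmallDigits (unitRow (sevens n) k) ∧ eval n y (unitRow (sevens n) k) = y (k + 10) := by
  obtain ⟨m, hm, hu⟩ : ∃ m, (∀ j, 10 ≤ j → dig m j = 0) ∧
      unitRow (sevens n) k = 1 * (1 <<< (6 * (k + 10))) + (m &&& sevens n) :=
    ⟨Nat.mod (Nat.mul (Nat.succ k) 11400714819323198485) (Nat.pow 64 10),
      fun j hj => dig_eq_zero (Nat.mod_lt _ (by norm_num)) hj, by rw [one_mul]; rfl⟩
  have h : ∀ j, 1 * dig (1 <<< (6 * (k + 10))) j + dig (m &&& sevens n) j ≤ 7 := fun j => by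
    rw [dig_shiftLeft (by norm_num), dig_land_sevens]
    split_ifs with h1 h2
    · subst h1
      rw [hm _ (by omega)]
      norm_num
    all_goals omega
  have key : ∀ j, dig (unitRow (sevens n) k) j =
      1 * dig (1 <<< (6 * (k + 10))) j + dig (m &&& sevens n) j := fun j => by
    rw [hu, dig_add_mul fun j => (h j).trans_lt (by norm_num)]
  refine ⟨fun j => (key j).trans_le (h j), ?_⟩
  rw [eval, Finset.sum_eq_single_of_mem (k + 10) (Finset.mem_range.2 hk)]
  · rw [key, dig_shiftLeft (by norm_num), dig_land_sevens, hm _ (by omega)]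
    simp
  · intro j _ hj
    rw [key, dig_shiftLeft (by norm_num), dig_land_sevens, if_neg hj]
    rcases lt_or_ge j 10 with h | h
    · rw [hy j h, smul_zero]
    · rw [hm j h]
      simp

def Pivots.Sound (n : ℕ) (y : ℕ → V) : Pivots → Prop
  | .nil => True
  | .cons s p l => (∃ i, s = 6 * i) ∧ SmallDigits p ∧ eval n y p = 0 ∧ l.Sound n y

theorem Pivots.Sound.reduce {n x : ℕ} {y : ℕ → V} (hy : ∀ j, 7 • y j = 0) {l : Pivots}
    (hl : l.Sound n y) (hx : SmallDigits x) (hx0 : eval n y x = 0) :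
    SmallDigits (l.reduce (sevens n) x) ∧ eval n y (l.reduce (sevens n) x) = 0 := by
  induction l with
  | nil => exact ⟨hx, hx0⟩
  | cons s p l ih =>
    obtain ⟨-, hp, hp0, hl⟩ := hl
    obtain ⟨h, h0⟩ := ih hl
    change SmallDigits (step _ s p (l.reduce (sevens n) x)) ∧
      eval n y (step _ s p (l.reduce (sevens n) x)) = 0
    rw [step, force_eq]
    cases entry (l.reduce (sevens n) x) s with
    | zero => exact ⟨h, h0⟩
    | succ v =>
      have := addMul_spec (n := n) hy (d := Nat.sub 6 v)
        ((Nat.sub_le 6 v).trans (by norm_num)) hp h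
      rw [hp0, h0, smul_zero, add_zero] at this
      exact this

theorem monic_spec {n s x : ℕ} {y : ℕ → V} (hy : ∀ j, 7 • y j = 0) (hx : SmallDigits x)
    (hx0 : eval n y x = 0) :
    SmallDigits (monic (sevens n) s x) ∧ eval n y (monic (sevens n) s x) = 0 := by
  have := addMul_spec (n := n) hy (d := Nat.mod (Nat.pow (entry x s) 5) 7)
    (Nat.mod_lt _ (by norm_num)).le hx smallDigits_zero
  rw [hx0, smul_zero, zero_add] at this
  exact ⟨this.1, this.2.trans (by simp [eval, zero_dig])⟩

theorem Pivots.known_cons (M s p : ℕ) (l : Pivots) (K : ℕ) :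
    (Pivots.cons s p l).known M K =
      bif Nat.beq (entry p s) 1 && Nat.beq (p &&& ((K ||| 7 <<< s) ^^^ M))
        (7 * ((p &&& ((K ||| 7 <<< s) ^^^ M)) / 7 &&& M))
      then l.known M (K ||| 7 <<< s) else l.known M K := by
  change force (K ||| 7 <<< s) (fun K' => force (p &&& (K' ^^^ M)) fun r =>
    @Bool.rec (fun _ => ℕ) (l.known M K) (l.known M K')
      (Nat.beq (entry p s) 1 && Nat.beq r (7 * (r / 7 &&& M)))) = _
  rw [force_eq, force_eq]
  cases Nat.beq (entry p s) 1 && _ <;> rfl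

theorem Pivots.Sound.known {n : ℕ} {y : ℕ → V} (hy : ∀ j, 7 • y j = 0) {l : Pivots}
    (hl : l.Sound n y) {K : ℕ} (hK : ∀ j < n, dig K j ≠ 0 → y j = 0) :
    ∀ j < n, dig (l.known (sevens n) K) j ≠ 0 → y j = 0 := by
  induction l generalizing K with
  | nil => exact hK
  | cons s p l ih =>
    obtain ⟨⟨i, rfl⟩, hp, hp0, hl⟩ := hl
    rw [Pivots.known_cons]
    cases hb : (Nat.beq (entry p (6 * i)) 1 &&
      Nat.beq (p &&& ((K ||| 7 <<< (6 * i)) ^^^ sevens n))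
        (7 * ((p &&& ((K ||| 7 <<< (6 * i)) ^^^ sevens n)) / 7 &&& sevens n))) with
    | false => exact ih hl hK
    | true =>
      refine ih hl fun j hj hd => ?_
      rw [Bool.and_eq_true, Nat.beq_eq, Nat.beq_eq, entry_eq] at hb
      obtain ⟨h1, h2⟩ := hb
      rw [dig_lor, dig_shiftLeft (by norm_num)] at hd
      by_cases hji : j = i
      swap
      · rw [if_neg hji, Nat.or_zero] at hd
        exact hK j hj hd
      subst hji
      have hother : ∀ i ∈ Finset.range n, i ≠ j → dig p i • y i = 0 := by
        intro i hi hij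
        have hi := Finset.mem_range.1 hi
        by_cases hKi : dig K i = 0
        swap
        · rw [hK i hi hKi, smul_zero]
        set t := (p &&& ((K ||| 7 <<< (6 * j)) ^^^ sevens n)) / 7 with ht
        have h3 : dig (p &&& ((K ||| 7 <<< (6 * j)) ^^^ sevens n)) i = dig p i := by
          rw [dig_land, dig_xor, dig_lor, dig_shiftLeft (by norm_num), if_neg hij, hKi, dig_sevens,
            if_pos hi]
          change dig p i &&& 7 = dig p i
          rw [land_seven]
          have := hp i
          omega
        have h4 := dig_add_mul (d := 7) (a := t &&& sevens n) (b := 0) (fun j => by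
          rw [dig_land_sevens]
          rw [zero_dig]
          split_ifs <;> omega) i
        rw [add_zero, ← h2, h3] at h4
        rw [h4, zero_dig, add_zero, mul_smul, smul_comm, hy, smul_zero]
      have h5 := hp0
      rw [eval, Finset.sum_eq_single_of_mem j (Finset.mem_range.2 hj) hother] at h5
      have h6 : dig p j = 1 := by
        have := hp j
        omega
      rwa [h6, one_smul] at h5

end PackedVectors

section Elimination

def encode (a b c d : ℕ) : ℕ :=
  Nat.add d (Nat.mul 5 (Nat.add c (Nat.mul 5 (Nat.add b (Nat.mul 5 a)))))

/-- Adds the linear combination `l` of words to the packed vector `x`. The result is `0` if one of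
the words is divergent. -/
def toRow (M : ℕ) (l : List (ℤ × List ℕ)) : ℕ → ℕ :=
  List.rec (fun x => x) (fun q _ ih x => match q with
    | (e, [a, b, c, d]) => Bool.rec 0
        (force (encode a b c d) fun k => force (addMul M (e % 7).toNat (unitRow M k) x) ih)
        (Conv [a, b, c, d])
    | _ => 0) l

/-- The bit position of the entry for a word given by its decimal code. -/
def toShift (k : ℕ) : ℕ :=
  match dec 5 k [] with
  | [a, b, c, d] => Nat.mul 6 (Nat.add (encode a b c d) 10)
  | _ => 0

/-- Gaussian elimination on the relations with codes `l`, the pivots being prescribed. -/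
def solve (M : ℕ) (l : List (ℕ × ℕ × ℕ)) : Pivots → Pivots :=
  List.rec (fun p => p) (fun t _ ih p =>
    match t with
    | (u, v, k) =>
      force (toShift k) fun s =>
      force (p.reduce M (toRow M (terms u v) 0)) fun x =>
      force (monic M s x) fun x => ih (.cons s x p)) l

def initial : List ℕ → ℕ
  | [] => 64 ^ 10 - 1
  | k :: l => Nat.lor (Nat.shiftLeft 7 (toShift k)) (initial l)

def determined (M : ℕ) (relations : List (ℕ × ℕ × ℕ)) (basis : List ℕ) : Bool :=
  force ((solve M relations .nil).known M (initial basis)) fun K =>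
    (List.range 4).all fun a => (List.range 5).all fun b => (List.range 5).all fun c =>
      [1, 2, 3, 4].all fun d => Nat.beq (entry K (Nat.mul 6 (Nat.add (encode a b c d) 10))) 7

variable {V : Type*} [AddCommGroup V]

def coords (X : List ℕ → V) (j : ℕ) : V :=
  if j < 10 then 0 else X [(j - 10) / 125, (j - 10) / 25 % 5, (j - 10) / 5 % 5, (j - 10) % 5]

theorem coords_encode (X : List ℕ → V) {a b c d : ℕ} (hb : b < 5) (hc : c < 5) (hd : d < 5) :
    coords X (encode a b c d + 10) = X [a, b, c, d] := by
  have h : encode a b c d = d + 5 * (c + 5 * (b + 5 * a)) := rfl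
  rw [coords, if_neg (by omega)]
  congr <;> omega

theorem smul_coords {X : List ℕ → V} (hX : ∀ w, 7 • X w = 0) (j : ℕ) : 7 • coords X j = 0 := by
  rw [coords]
  split_ifs
  exacts [smul_zero _, hX _]

theorem Conv.bounds {a b c d : ℕ} (h : Conv [a, b, c, d]) :
    a < 4 ∧ b < 5 ∧ c < 5 ∧ d < 5 ∧ 0 < d := by
  simp [Conv, Good] at h
  omega

theorem toRow_spec {X : List ℕ → V} (hX : ∀ w, 7 • X w = 0) {l : List (ℤ × List ℕ)} {x : ℕ}
    (hx : SmallDigits x)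
    (h : (∀ q ∈ l, Conv q.2 ∧ q.2.length = 4) →
      eval 641 (coords X) x + (l.map fun q => q.1 • X q.2).sum = 0) :
    SmallDigits (toRow (sevens 641) l x) ∧ eval 641 (coords X) (toRow (sevens 641) l x) = 0 := by
  have h0 : SmallDigits 0 ∧ eval 641 (coords X) 0 = 0 :=
    ⟨smallDigits_zero, by simp [eval, zero_dig]⟩
  induction l generalizing x with
  | nil =>
    refine ⟨hx, ?_⟩
    have := h (by simp)
    rwa [List.map_nil, List.sum_nil, add_zero] at this
  | cons q l ih =>
    obtain ⟨e, w⟩ := q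
    match w, h with
    | [], _ | [_], _ | [_, _], _ | [_, _, _], _ | _ :: _ :: _ :: _ :: _ :: _, _ => exact h0
    | [a, b, c, d], h =>
      cases hw : Conv [a, b, c, d] with
      | false =>
        have : toRow (sevens 641) ((e, [a, b, c, d]) :: l) x = 0 := by
          change @Bool.rec (fun _ => ℕ) _ _ (Conv [a, b, c, d]) = 0
          rw [hw]
        rwa [this]
      | true =>
        have key : toRow (sevens 641) ((e, [a, b, c, d]) :: l) x = toRow (sevens 641) l
            (addMul (sevens 641) (e % 7).toNat (unitRow (sevens 641) (encode a b c d)) x) := by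
          change @Bool.rec (fun _ => ℕ) _ (force _ fun k => force _ (toRow (sevens 641) l))
            (Conv [a, b, c, d]) = _
          rw [hw, force_eq, force_eq]
        obtain ⟨ha, hb, hc, hd, -⟩ := Conv.bounds hw
        have hk : encode a b c d + 10 < 641 := by
          change d + 5 * (c + 5 * (b + 5 * a)) + 10 < 641
          omega
        obtain ⟨hu, hu'⟩ := unitRow_spec (y := coords X) (fun j hj => if_pos hj) hk
        obtain ⟨hm, hm'⟩ := addMul_spec (n := 641) (smul_coords hX) (d := (e % 7).toNat)
          (by omega) hu hx
        rw [key]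
        refine ih hm fun hl => ?_
        have h := h (List.forall_mem_cons.2 ⟨⟨hw, rfl⟩, hl⟩)
        have he : (e % 7).toNat • X [a, b, c, d] = e • X [a, b, c, d] := by
          conv_rhs => rw [← Int.mul_ediv_add_emod e 7]
          rw [← natCast_zsmul, Int.toNat_of_nonneg (by omega), add_smul, mul_comm, mul_smul,
            ofNat_zsmul, hX, smul_zero, zero_add]
        rw [hm', hu', coords_encode X hb hc hd, he, add_comm (e • _), add_assoc]
        rwa [List.map_cons, List.sum_cons] at h

theorem toShift_eq (X : List ℕ → V) (k : ℕ) :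
    ∃ i, toShift k = 6 * i ∧ (X (dec 5 k []) = 0 → coords X i = 0) := by
  have hdec : ∀ f n acc, (∀ a ∈ acc, a < 5) → ∀ a ∈ dec f n acc, a < 5 := by
    intro f
    induction f with
    | zero => exact fun n acc h => h
    | succ f ih =>
      intro n acc h
      rw [dec]
      split_ifs
      · exact h
      · exact ih _ _ (List.forall_mem_cons.2 ⟨Nat.mod_lt _ (by norm_num), h⟩)
  have h := hdec 5 k [] (by simp)
  rw [toShift]
  split
  · next a b c d hw =>
    rw [hw] at h ⊢
    simp only [List.forall_mem_cons] at h
    exact ⟨encode a b c d + 10, rfl, fun hx => by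
      rw [coords_encode X h.2.1 h.2.2.1 h.2.2.2.1, hx]⟩
  · exact ⟨0, rfl, fun _ => if_pos (by norm_num)⟩

theorem solve_sound {X : List ℕ → V} (hX : ∀ w, 7 • X w = 0)
    (hrel : ∀ u v, (∀ q ∈ terms u v, Conv q.2 ∧ q.2.length = 4) →
      ((terms u v).map fun q => q.1 • X q.2).sum = 0)
    (l : List (ℕ × ℕ × ℕ)) {p : Pivots} (hp : p.Sound 641 (coords X)) :
    (solve (sevens 641) l p).Sound 641 (coords X) := by
  induction l generalizing p with
  | nil => exact hp
  | cons t l ih =>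
    obtain ⟨u, v, k⟩ := t
    change Pivots.Sound _ _ (force _ fun s => force _ fun x => force _ fun x =>
      solve (sevens 641) l (.cons s x p))
    rw [force_eq, force_eq, force_eq]
    obtain ⟨i, hi, -⟩ := toShift_eq X k
    have h := toRow_spec hX (l := terms u v) smallDigits_zero fun hq => by
      rw [hrel u v hq, add_zero]
      simp [eval, zero_dig]
    have h := hp.reduce (smul_coords hX) h.1 h.2
    have h := monic_spec (s := toShift k) (smul_coords hX) h.1 h.2
    exact ih ⟨⟨i, hi⟩, h.1, h.2, hp⟩

theorem initial_sound {X : List ℕ → V} (l : List ℕ) (hl : ∀ k ∈ l, X (dec 5 k []) = 0) (j : ℕ)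
    (hj : dig (initial l) j ≠ 0) : coords X j = 0 := by
  induction l with
  | nil =>
    refine if_pos ?_
    by_contra h
    exact hj (dig_eq_zero (n := 10) (by norm_num [initial]) (by omega))
  | cons k l ih =>
    obtain ⟨i, hi, hX⟩ := toShift_eq X k
    change dig (7 <<< toShift k ||| initial l) j ≠ 0 at hj
    rw [hi, dig_lor, dig_shiftLeft (by norm_num)] at hj
    rw [List.forall_mem_cons] at hl
    split_ifs at hj with h
    · rw [h, hX hl.1]
    · exact ih hl.2 (by simpa using hj)

theorem eq_zero_of_determined {X : List ℕ → V} (hX : ∀ w, 7 • X w = 0)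
    (hrel : ∀ u v, (∀ q ∈ terms u v, Conv q.2 ∧ q.2.length = 4) →
      ((terms u v).map fun q => q.1 • X q.2).sum = 0)
    {relations : List (ℕ × ℕ × ℕ)} {basis : List ℕ}
    (h : (force (sevens 641) fun M => determined M relations basis) = true)
    (hb : ∀ k ∈ basis, X (dec 5 k []) = 0) {w : List ℕ} (hw : Conv w) (hlen : w.length = 4) :
    X w = 0 := by
  obtain ⟨a, b, c, d, rfl⟩ := List.length_eq_four.1 hlen
  obtain ⟨ha, hb', hc, hd, hd'⟩ := Conv.bounds hw
  rw [force_eq, determined, force_eq] at h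
  simp only [List.all_eq_true, List.mem_range, Nat.beq_eq] at h
  have h := h a ha b hb' c hc d (by simp; omega)
  change entry _ (6 * (encode a b c d + 10)) = 7 at h
  rw [entry_eq] at h
  have hk : encode a b c d + 10 < 641 := by
    change d + 5 * (c + 5 * (b + 5 * a)) + 10 < 641
    omega
  rw [← coords_encode X hb' hc hd]
  refine Pivots.Sound.known (smul_coords hX) (solve_sound hX hrel relations (p := .nil) trivial)
    (fun j _ => initial_sound basis hb j) _ hk fun h0 => ?_
  rw [h0] at h
  norm_num at h

end Elimination

def relationCodes : List (ℕ × ℕ × ℕ) := [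
  (54, 54, 5544), (51, 51, 5552), (54, 51, 5551), (3, 554, 5553), (52, 52, 5554), (52, 24, 5542),
  (3, 334, 3334), (1, 114, 1114), (3, 354, 3354), (1, 154, 1154), (11, 11, 1111), (3, 333, 3333),
  (14, 14, 1144), (34, 34, 3344), (54, 53, 5543), (54, 14, 5144), (54, 34, 5344), (2, 222, 2444),
  (22, 22, 2454), (54, 24, 2554), (2, 524, 2542), (1, 554, 5541), (34, 33, 3343), (1, 141, 1141),
  (53, 53, 5533), (1, 514, 5114), (51, 14, 5141), (3, 534, 5334), (53, 34, 5343), (1, 511, 5111),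
  (3, 533, 5333), (2, 254, 5452), (51, 11, 1152), (0, 2442, 2442), (1, 153, 1153),
  (3, 351, 3351), (3, 154, 1453), (1, 354, 3451), (0, 2452, 2422), (0, 2352, 2412),
  (0, 2152, 2432), (0, 5252, 2424), (0, 3352, 2411), (0, 2253, 1422), (0, 2251, 3422),
  (0, 1252, 2423), (0, 5352, 2414), (0, 5152, 2434), (0, 3252, 2421), (0, 2254, 5422),
  (0, 2153, 1432), (0, 2453, 2453), (0, 3452, 2451), (0, 5253, 1424), (0, 2351, 3412),
  (0, 5251, 3424), (0, 2151, 3432), (0, 1352, 2413), (0, 3152, 2431), (0, 5254, 5424),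
  (0, 2132, 2232), (0, 2142, 2142), (0, 1122, 2233), (0, 1142, 1142), (0, 1112, 1112),
  (0, 2112, 2112), (0, 5122, 2234), (0, 3122, 3122), (0, 2124, 2124), (0, 2123, 2123),
  (0, 2212, 2212), (0, 2342, 2342), (0, 3332, 3332), (0, 3322, 3322), (0, 5322, 2214),
  (0, 1322, 1322), (0, 2324, 2324), (0, 2321, 2321), (0, 2242, 2242), (0, 3552, 2441),
  (0, 1552, 2443), (0, 5522, 2244), (0, 3522, 2241), (0, 1522, 2243), (0, 2551, 3442),
  (0, 2553, 1442), (0, 2523, 1242), (0, 2521, 3242), (0, 1551, 3443), (0, 3551, 3441),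
  (0, 1553, 1443), (0, 3553, 1441), (0, 5232, 2224), (0, 5223, 1224), (0, 5221, 3224),
  (0, 2121, 3232), (0, 5412, 5412), (0, 1124, 1124), (3, 324, 3324), (0, 5242, 5242),
  (0, 5432, 5432), (1, 134, 1134), (3, 314, 3314), (0, 2133, 1132), (0, 2141, 2141),
  (0, 5112, 2334), (0, 1512, 2343), (0, 1133, 1233), (0, 2343, 1212), (2, 224, 5442),
  (0, 2514, 5342), (0, 5321, 3214), (0, 5123, 1234), (0, 2534, 5142), (53, 33, 3353),
  (0, 5421, 5421), (0, 1254, 5423), (0, 3323, 1211), (0, 1212, 2223), (0, 1221, 3223),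
  (1, 143, 1143), (6, 331, 3331), (0, 3451, 3251), (3, 341, 3341), (1, 133, 1133),
  (1, 551, 5512), (0, 1423, 1253), (1, 544, 5411), (0, 2511, 3342), (0, 2134, 2134),
  (0, 5312, 2314), (0, 2131, 3132), (0, 3253, 1421), (0, 3453, 1451), (0, 2411, 2222),
  (0, 5234, 5124), (0, 5214, 5324), (0, 1243, 1243), (0, 3521, 3241), (0, 5244, 5524),
  (1, 151, 1151), (0, 5243, 1524), (0, 5241, 3524), (3, 254, 5153), (0, 3121, 3121),
  (3, 532, 5351), (0, 5341, 5341), (0, 5143, 5143), (0, 5532, 2144), (2, 131, 1313),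
  (0, 1532, 2143), (0, 3514, 2341), (0, 5521, 3244), (0, 3523, 1241), (0, 3431, 3431),
  (0, 3211, 3211), (2, 531, 5513), (0, 5332, 2114), (2, 513, 5531), (0, 5544, 2544),
  (6, 123, 1213), (0, 2454, 5454), (3, 344, 3433), (0, 1554, 5443), (0, 3554, 5441),
  (0, 2331, 3112), (0, 2113, 2113), (0, 2353, 1412), (0, 3142, 3142), (0, 1113, 1113),
  (0, 2543, 1542), (0, 3542, 2541), (0, 3233, 1121), (0, 2311, 2311), (1, 323, 5434),
  (1, 521, 5211), (0, 5331, 3114), (0, 5554, 5444), (0, 3313, 3313), (0, 1451, 3423),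
  (0, 5523, 1244), (0, 1354, 5413), (0, 3154, 5431), (1, 532, 1543), (3, 512, 3541),
  (0, 1131, 1131), (0, 1331, 3113), (6, 513, 5113), (0, 1351, 3413), (0, 3153, 1431),
  (2, 151, 1553), (3, 353, 3352), (2, 353, 3551), (0, 1454, 5453), (0, 5353, 1414),
  (6, 531, 5311), (3, 253, 2533), (1, 251, 2511), (0, 1312, 2313), (0, 1152, 2433),
  (0, 3243, 3243), (0, 2513, 1342), (0, 1513, 1343), (0, 5131, 3134), (0, 1314, 1314),
  (3, 543, 5433), (0, 5354, 5354), (2, 522, 5244), (0, 5551, 3444), (2, 512, 5134),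
  (3, 153, 1533), (1, 351, 3511), (0, 1414, 1214), (3, 233, 2333), (0, 5512, 2344),
  (3, 252, 2551), (0, 5451, 3454), (0, 3513, 1341), (0, 1531, 3143), (0, 5213, 1324),
  (1, 523, 1523), (0, 1413, 1413), (3, 521, 3514), (3, 553, 5532), (54, 23, 2543),
  (0, 5431, 3124), (1, 311, 3111), (3, 133, 1333), (0, 5151, 3434), (0, 5553, 1444),
  (2, 552, 5224), (54, 52, 5522), (0, 1411, 1411), (0, 3123, 1231), (0, 3434, 5121),
  (24, 22, 2254), (31, 31, 3311), (0, 3141, 3141), (1, 212, 2153), (2, 313, 3131),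
  (3, 323, 3233), (1, 252, 1353), (2, 242, 2452), (0, 1514, 3543), (2, 154, 5243),
  (2, 352, 5154), (0, 1321, 1321), (1, 211, 2111), (0, 1323, 1223), (6, 523, 5233),
  (0, 5541, 3544), (3, 513, 5133), (2, 544, 5511), (2, 554, 5252), (2, 244, 2252),
  (0, 5444, 2552), (6, 552, 5521), (3, 531, 5314), (7, 52, 5251), (2, 251, 1454), (2, 253, 5451),
  (0, 5543, 1544), (0, 1433, 1433), (52, 12, 1554), (6, 151, 1351), (0, 3351, 3411),
  (0, 3144, 3144), (0, 1434, 1434), (1, 123, 1123), (6, 321, 3221), (6, 532, 5332),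
  (52, 31, 3153), (1, 224, 1331), (0, 3534, 1541), (6, 232, 2312), (0, 1334, 1334),
  (3, 321, 3321), (2, 354, 5241), (6, 323, 3231), (2, 214, 2154), (0, 3414, 3414),
  (6, 213, 2133), (54, 33, 5253), (3, 234, 5112), (52, 32, 3554), (0, 5513, 1344),
  (6, 224, 3522), (2, 514, 2514), (12, 12, 1122), (3, 523, 1551), (6, 242, 2352), (3, 313, 1311),
  (2, 113, 3133), (21, 21, 2211), (1, 221, 1332), (2, 351, 2351), (1, 352, 1354), (3, 343, 3453),
  (2, 243, 3452), (2, 213, 3154), (7, 22, 2253), (2, 324, 3542), (32, 32, 5514), (6, 521, 1532),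
  (2, 144, 1452), (1, 124, 1531), (53, 24, 5313), (24, 32, 2131), (0, 3343, 3533),
  (33, 33, 3323), (23, 33, 3312), (2, 134, 1312), (2, 534, 2534), (53, 23, 3253), (1, 541, 1511),
  (3, 223, 2331), (51, 21, 1251), (52, 13, 5131), (0, 3344, 3534), (2, 234, 2132),
  (2, 232, 5414), (6, 142, 1423), (0, 5144, 1514), (6, 353, 3531), (6, 512, 3123), (7, 32, 3421),
  (14, 22, 1221), (0, 5211, 3213), (2, 532, 5331), (23, 23, 1254), (7, 21, 1323), (52, 14, 1552),
  (6, 342, 2251), (54, 12, 1512), (2, 314, 2332), (0, 1111, 2323), (54, 21, 5151),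
  (34, 32, 2151), (22, 34, 2213), (52, 34, 3254), (6, 254, 1534), (2, 312, 3151), (6, 352, 5323),
  (51, 52, 5353), (1, 534, 1513), (2, 334, 1521), (2, 223, 3513), (1, 522, 3523), (53, 21, 3532),
  (7, 13, 3234), (2, 142, 2513), (22, 23, 2531), (3, 144, 2353), (12, 34, 5132), (1, 321, 3512),
  (3, 221, 5523), (24, 33, 5312), (3, 131, 5234), (51, 31, 5223), (1, 142, 2553), (6, 211, 2122),
  (3, 222, 2521), (54, 11, 3521), (6, 313, 5123), (3, 141, 2152), (2, 152, 2512), (6, 544, 1232),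
  (0, 1144, 5321), (7, 51, 3222), (6, 111, 2221), (51, 53, 5122), (3, 214, 5534), (3, 352, 3552),
  (13, 23, 1222), (7, 53, 5222), (1, 122, 5352), (0, 5411, 1352), (3, 132, 5254), (3, 342, 5152),
  (3, 212, 1252), (1, 213, 5231), (2, 543, 2522), (7, 14, 2354), (32, 33, 2524)]

def basisCodes : List ℕ := [
  5214, 5212, 5213, 5221, 5232, 5322, 1522, 2523, 2532, 2121, 2231, 2322, 3553, 3152, 3252, 3212]

set_option maxRecDepth 10000 in
theorem determined_basisCodes :
    (force (sevens 641) fun M => determined M relationCodes basisCodes) = true := by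
  decide +kernel

theorem eq_zero_of_le_smul {A : Type*} [AddCommGroup A] [Module ℚ A] {N : Submodule ℤ A}
    (hN : N.FG) (h : ∀ x ∈ N, ∃ z ∈ N, x = (7 : ℤ) • z) {x : A} (hx : x ∈ N) : x = 0 := by
  obtain ⟨r, hr, hr'⟩ := Submodule.exists_sub_one_mem_and_smul_eq_zero_of_fg_of_le_smul
    (Ideal.span {(7 : ℤ)}) N hN fun x hx => by
      obtain ⟨z, hz, rfl⟩ := h x hx
      exact Submodule.smul_mem_smul (Ideal.mem_span_singleton_self 7) hz
  have hr0 : r ≠ 0 := by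
    rintro rfl
    rw [Ideal.mem_span_singleton] at hr
    norm_num at hr
  have := hr' x hx
  rw [← Int.cast_smul_eq_zsmul ℚ] at this
  exact (smul_eq_zero.1 this).resolve_left (Int.cast_ne_zero.2 hr0)

theorem mem_span_of_relations {E : Type*} [AddCommGroup E] [Module ℚ E] (Z : List ℕ → E)
    (hrel : ∀ u v, (∀ q ∈ terms u v, Conv q.2) → ((terms u v).map fun q => q.1 • Z q.2).sum = 0)
    {w : List ℕ} (hw : Conv w) (hlen : w.length = 4) :
    Z w ∈ Submodule.span ℚ (Set.range fun i : Fin 16 => Z (dec 5 (basisCodes.get i) [])) := by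
  set B := Submodule.span ℚ (Set.range fun i : Fin 16 => Z (dec 5 (basisCodes.get i) [])) with hB
  let x : List ℕ → E ⧸ B := fun w => if Conv w ∧ w.length = 4 then B.mkQ (Z w) else 0
  let f : Fin 5 × Fin 5 × Fin 5 × Fin 5 → E ⧸ B := fun t => x [t.1, t.2.1, t.2.2.1, t.2.2.2]
  have hf : ∀ w, x w ∈ Submodule.span ℤ (Set.range f) := fun w => by
    by_cases hw : Conv w ∧ w.length = 4
    · obtain ⟨a, b, c, d, rfl⟩ := List.length_eq_four.1 hw.2
      obtain ⟨ha, hb, hc, hd, -⟩ := Conv.bounds hw.1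
      exact Submodule.subset_span ⟨⟨⟨a, by omega⟩, ⟨b, hb⟩, ⟨c, hc⟩, ⟨d, hd⟩⟩, rfl⟩
    · simp only [x, if_neg hw, Submodule.zero_mem]
  let P : Submodule ℤ (E ⧸ B) :=
    (Submodule.span ℤ (Set.range f)).map (LinearMap.lsmul ℤ (E ⧸ B) 7)
  have key : ∀ w, x w ∈ P := fun w => by
    by_cases hw : Conv w ∧ w.length = 4
    swap
    · simp only [x, if_neg hw, Submodule.zero_mem]
    rw [← Submodule.Quotient.mk_eq_zero]
    refine eq_zero_of_determined (X := fun w => P.mkQ (x w)) (fun w => ?_) (fun u v h => ?_)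
      determined_basisCodes (fun k hk => ?_) hw.1 hw.2
    · rw [← ofNat_zsmul, ← map_zsmul]
      exact (Submodule.Quotient.mk_eq_zero P).2 (Submodule.mem_map_of_mem (hf w))
    · have : ((terms u v).map fun q => q.1 • x q.2) =
          ((terms u v).map fun q => q.1 • Z q.2).map B.mkQ := by
        rw [List.map_map]
        refine List.map_congr_left fun q hq => ?_
        simp only [x, if_pos (h q hq), Function.comp_apply, map_zsmul]
      have h2 : ((terms u v).map fun q => q.1 • P.mkQ (x q.2)) =
          ((terms u v).map fun q => q.1 • x q.2).map P.mkQ := by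
        rw [List.map_map]
        simp only [Function.comp_def, map_zsmul]
      rw [h2, ← map_list_sum, this, ← map_list_sum, hrel u v fun q hq => (h q hq).1, map_zero,
        map_zero]
    · obtain ⟨i, rfl⟩ := List.get_of_mem hk
      have : B.mkQ (Z (dec 5 (basisCodes.get i) [])) = 0 :=
        (Submodule.Quotient.mk_eq_zero B).2 (Submodule.subset_span ⟨i, rfl⟩)
      simp only [x, this, ite_self, map_zero]
  have h0 : x w = 0 := by
    refine eq_zero_of_le_smul (Submodule.fg_span (Set.finite_range f)) (fun y hy => ?_) (hf w)
    have hle : Submodule.span ℤ (Set.range f) ≤ P :=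
      Submodule.span_le.2 (Set.range_subset_iff.2 fun t => key _)
    obtain ⟨z, hz, rfl⟩ := hle hy
    exact ⟨z, hz, rfl⟩
  simp only [x, if_pos (And.intro hw hlen)] at h0
  exact (Submodule.Quotient.mk_eq_zero B).1 h0

section PowerSeries

/-- The inverse of the singularity of the differential form of a letter. -/
def root (a : ℕ) : ℂ := if a = 0 then 0 else Complex.I ^ a

theorem norm_root_le (a : ℕ) : ‖root a‖ ≤ 1 := by
  rw [root]
  split_ifs <;> simp

/-- The power series coefficients at `0` of the iterated integral of a word. -/
def coef : List ℕ → ℕ → ℂ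
  | [], n => if n = 0 then 1 else 0
  | 0 :: w, n => coef w n / n
  | (a + 1) :: w, n => (∑ m ∈ Finset.range n, root (a + 1) ^ (n - m) * coef w m) / n

theorem coef_cons_zero (a : ℕ) (w : List ℕ) : coef (a :: w) 0 = 0 := by
  cases a <;> simp [coef]

theorem norm_coef_zero_le (w : List ℕ) : ‖coef w 0‖ ≤ 1 := by
  cases w with
  | nil => simp [coef]
  | cons a w => simp [coef_cons_zero]

theorem sum_le_of_le_div_sqrt {c : ℕ → ℝ} {C : ℝ} (hC : 0 ≤ C) (h0 : c 0 ≤ 1)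
    (hc : ∀ n, 1 ≤ n → c n ≤ C / √n) (n : ℕ) (hn : 1 ≤ n) :
    ∑ m ∈ Finset.range n, c m ≤ (1 + 2 * C) * √n := by
  have key : ∀ n : ℕ, ∑ m ∈ Finset.range (n + 1), c m ≤ 1 + 2 * C * √n := by
    intro n
    induction n with
    | zero => simpa using h0
    | succ n ih =>
      rw [Finset.sum_range_succ]
      have h1 := hc (n + 1) (by omega)
      have hs : 0 < √((n + 1 : ℕ) : ℝ) := Real.sqrt_pos.2 (by positivity)
      have h2 : √((n + 1 : ℕ) : ℝ) * √((n + 1 : ℕ) : ℝ) = n + 1 := by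
        rw [Real.mul_self_sqrt (by positivity)]
        push_cast
        rfl
      have h3 : √(n : ℝ) * √(n : ℝ) = n := Real.mul_self_sqrt (by positivity)
      have h4 : C / √((n + 1 : ℕ) : ℝ) ≤ 2 * C * √((n + 1 : ℕ) : ℝ) - 2 * C * √n := by
        rw [div_le_iff₀ hs]
        nlinarith [mul_nonneg hC (sq_nonneg (√((n + 1 : ℕ) : ℝ) - √n))]
      linarith
  obtain ⟨m, rfl⟩ : ∃ m, n = m + 1 := ⟨n - 1, by omega⟩
  have h1 : (1 : ℝ) ≤ √((m + 1 : ℕ) : ℝ) := Real.one_le_sqrt.2 (by simp)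
  have h2 : √(m : ℝ) ≤ √((m + 1 : ℕ) : ℝ) := Real.sqrt_le_sqrt (by simp)
  nlinarith [key m]

theorem exists_norm_coef_le (w : List ℕ) :
    ∃ C : ℝ, 0 ≤ C ∧ ∀ n : ℕ, 1 ≤ n → ‖coef w n‖ ≤ C / √n := by
  induction w with
  | nil =>
    refine ⟨0, le_rfl, fun n hn => ?_⟩
    simp [coef, Nat.one_le_iff_ne_zero.1 hn]
  | cons a w ih =>
    obtain ⟨C, hC, h⟩ := ih
    cases a with
    | zero =>
      refine ⟨C, hC, fun n hn => ?_⟩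
      rw [coef, norm_div, Complex.norm_natCast]
      exact (div_le_self (norm_nonneg _) (by exact_mod_cast hn)).trans (h n hn)
    | succ a =>
      refine ⟨1 + 2 * C, by positivity, fun n hn => ?_⟩
      have hs : 0 < √(n : ℝ) := Real.sqrt_pos.2 (by exact_mod_cast hn)
      have hn' : (0 : ℝ) < n := by exact_mod_cast hn
      rw [coef, norm_div, Complex.norm_natCast, div_le_div_iff₀ hn' hs]
      have h1 := sum_le_of_le_div_sqrt hC (norm_coef_zero_le w) h n hn
      have h2 : ‖∑ m ∈ Finset.range n, root (a + 1) ^ (n - m) * coef w m‖ ≤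
          ∑ m ∈ Finset.range n, ‖coef w m‖ := by
        refine norm_sum_le_of_le _ fun m _ => ?_
        rw [norm_mul, norm_pow]
        exact mul_le_of_le_one_left (norm_nonneg _) (pow_le_one₀ (norm_nonneg _) (norm_root_le _))
      calc _ ≤ (1 + 2 * C) * √(n : ℝ) * √n := by gcongr; exact h2.trans h1
        _ = _ := by rw [mul_assoc, Real.mul_self_sqrt hn'.le]

theorem tendsto_coef (w : List ℕ) : Tendsto (coef w) atTop (𝓝 0) := by
  obtain ⟨C, -, h⟩ := exists_norm_coef_le w
  refine squeeze_zero_norm' (eventually_atTop.2 ⟨1, h⟩) ?_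
  exact (Real.tendsto_sqrt_atTop.comp tendsto_natCast_atTop_atTop).const_div_atTop C

theorem summable_coef_div (w : List ℕ) : Summable fun n : ℕ => coef w n / n := by
  obtain ⟨C, -, h⟩ := exists_norm_coef_le w
  refine Summable.of_norm_bounded
    ((Real.summable_one_div_nat_rpow (p := 3 / 2)).2 (by norm_num) |>.mul_left C) fun n => ?_
  rcases Nat.eq_zero_or_pos n with rfl | hn
  · simp
  have hn' : (0 : ℝ) < n := by exact_mod_cast hn
  rw [norm_div, Complex.norm_natCast, show (3 / 2 : ℝ) = 1 / 2 + 1 by norm_num,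
    Real.rpow_add hn', Real.rpow_one, ← Real.sqrt_eq_rpow, ← div_div, mul_div_assoc', mul_one_div]
  gcongr
  exact h n hn

theorem coef_succ_mul (a : ℕ) (w : List ℕ) (n : ℕ) :
    (n + 1) * coef ((a + 1) :: w) (n + 1) =
      root (a + 1) * (n * coef ((a + 1) :: w) n + coef w n) := by
  have h : ∀ n : ℕ, n * coef ((a + 1) :: w) n =
      ∑ m ∈ Finset.range n, root (a + 1) ^ (n - m) * coef w m := fun n => by
    rcases Nat.eq_zero_or_pos n with rfl | hn
    · simp
    · rw [coef, mul_div_cancel₀]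
      exact_mod_cast hn.ne'
  have h1 := h (n + 1)
  push_cast at h1
  rw [h1, h, Finset.sum_range_succ, mul_add, Finset.mul_sum, Nat.add_sub_cancel_left, pow_one]
  congr 1
  refine Finset.sum_congr rfl fun m hm => ?_
  rw [Nat.succ_sub (Finset.mem_range.1 hm).le, pow_succ']
  ring

theorem root_ne_one {a : ℕ} (ha : a < 4) : root a ≠ 1 := by
  have h1 : (-1 : ℂ) ≠ 1 := by norm_num
  have h2 : Complex.I ≠ 1 := fun h => by simpa using congrArg Complex.re h
  have h3 : -Complex.I ≠ 1 := fun h => by simpa using congrArg Complex.re h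
  interval_cases a <;> simp [root, pow_succ, h1, h2, h3]

theorem exists_tendsto_sum_coef {w : List ℕ} (hw : Conv w) :
    ∃ l, Tendsto (fun m => ∑ n ∈ Finset.range m, coef w n) atTop (𝓝 l) := by
  match w with
  | [] =>
    refine ⟨1, tendsto_const_nhds.congr' (eventually_atTop.2 ⟨1, fun m hm => ?_⟩)⟩
    simp [coef, Nat.one_le_iff_ne_zero.1 hm]
  | 0 :: w => exact ⟨_, (summable_coef_div w).hasSum.tendsto_sum_nat⟩
  | (a + 1) :: w =>
    have ha : a + 1 < 4 := by
      rw [Conv, Bool.and_eq_true] at hw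
      have h1 : a ≠ 3 := by simpa using hw.1
      have := (Good.cons hw.2).1
      omega
    set b := coef ((a + 1) :: w) with hb
    set η := root (a + 1)
    have hη : 1 - η ≠ 0 := sub_ne_zero.2 (root_ne_one ha).symm
    have hsum : Summable fun n => b (n + 1) - η * b n := by
      have h1 : Summable fun n : ℕ => η * (coef w n / n) - b (n + 1) / (n + 1 : ℕ) * (1 + 1 / n) := by
        refine ((summable_coef_div w).mul_left η).sub ?_
        refine Summable.of_norm_bounded ((((summable_nat_add_iff 1).2
          (summable_coef_div ((a + 1) :: w))).norm).mul_left 2) fun n => ?_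
        rw [norm_mul, mul_comm]
        gcongr
        refine (norm_add_le _ _).trans ?_
        rw [norm_one, norm_div, norm_one, Complex.norm_natCast]
        have := Nat.cast_inv_le_one (α := ℝ) n
        rw [one_div]
        linarith
      refine (summable_nat_add_iff 1).1 (((summable_nat_add_iff 1).2 h1).congr fun n => ?_)
      have h2 := coef_succ_mul a w (n + 1)
      rw [← hb] at h2
      have h3 : ((n : ℂ) + 1) ≠ 0 := by exact_mod_cast n.succ_ne_zero
      have h4 : ((n : ℂ) + 1 + 1) ≠ 0 := by exact_mod_cast (n + 1).succ_ne_zero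
      push_cast at h2 ⊢
      field_simp
      linear_combination -h2
    refine ⟨(∑' n, (b (n + 1) - η * b n) + b 0 - 0) / (1 - η), ?_⟩
    refine (((hsum.hasSum.tendsto_sum_nat.add_const (b 0)).sub
      (tendsto_coef ((a + 1) :: w))).div_const (1 - η)).congr fun m => ?_
    rw [div_eq_iff hη, Finset.sum_sub_distrib, ← Finset.mul_sum]
    have h1 := Finset.sum_range_succ b m
    rw [Finset.sum_range_succ'] at h1
    linear_combination h1

/-- The iterated integral of a convergent word from `0` to `1`. -/
def value (w : List ℕ) : ℂ := limUnder atTop fun m => ∑ n ∈ Finset.range m, coef w n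

theorem tendsto_value {w : List ℕ} (hw : Conv w) :
    Tendsto (fun m => ∑ n ∈ Finset.range m, coef w n) atTop (𝓝 (value w)) :=
  tendsto_nhds_limUnder (exists_tendsto_sum_coef hw)

end PowerSeries

section Indices

theorem root_normExp (e : ℕ) : root (normExp e) = Complex.I ^ e := by
  rw [root, normExp, if_neg (by omega), pow_eq_pow_mod _ Complex.I_pow_four,
    pow_eq_pow_mod e Complex.I_pow_four]
  congr 1
  omega

theorem root_rotate (e a : ℕ) : root (rotate e a) = Complex.I ^ e * root a := by
  rcases Nat.eq_zero_or_pos a with rfl | ha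
  · simp [rotate, root]
  · rw [rotate, if_neg ha.ne', root_normExp, pow_add, root, if_neg ha.ne']

theorem coef_of_pos {a : ℕ} (ha : 0 < a) (w : List ℕ) (n : ℕ) :
    coef (a :: w) n = (∑ m ∈ Finset.range n, root a ^ (n - m) * coef w m) / n := by
  obtain ⟨b, rfl⟩ := Nat.exists_eq_succ_of_ne_zero ha.ne'
  rfl

theorem normExp_pos (e : ℕ) : 0 < normExp e := Nat.succ_pos _

theorem coef_map_rotate (e : ℕ) (w : List ℕ) (n : ℕ) :
    coef (w.map (rotate e)) n = (Complex.I ^ e) ^ n * coef w n := by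
  induction w generalizing n with
  | nil =>
    rcases Nat.eq_zero_or_pos n with rfl | hn
    · simp [coef]
    · simp [coef, hn.ne']
  | cons a w ih =>
    rw [List.map_cons]
    rcases Nat.eq_zero_or_pos a with rfl | ha
    · rw [rotate, if_pos rfl, coef, coef, ih, mul_div_assoc]
    · rw [coef_of_pos (by rw [rotate, if_neg ha.ne']; exact normExp_pos _), coef_of_pos ha,
        root_rotate, ← mul_div_assoc, Finset.mul_sum]
      congr 1
      refine Finset.sum_congr rfl fun m hm => ?_
      rw [ih, mul_pow, ← pow_sub_mul_pow (Complex.I ^ e) (Finset.mem_range.1 hm).le]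
      ring

theorem coef_replicate (s : ℕ) (w : List ℕ) (n : ℕ) :
    coef (List.replicate s 0 ++ w) n = coef w n / (n : ℂ) ^ s := by
  induction s with
  | zero => simp
  | succ s ih => rw [List.replicate_succ, List.cons_append, coef, ih, div_div, pow_succ]

/-- The partial sums of the multiple polylogarithm at powers of `I`. -/
def partialSum (l : List (ℕ × ℕ)) (m : ℕ) : ℂ :=
  mpvPartial (l.map fun p => (p.1, Complex.I ^ p.2)) m

theorem partialSum_cons_succ {s : ℕ} (hs : 0 < s) (e : ℕ) (t : List (ℕ × ℕ)) (m : ℕ) :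
    partialSum ((s, e) :: t) (m + 1) =
      partialSum ((s, e) :: t) m + (Complex.I ^ e) ^ m / (m : ℂ) ^ s * partialSum t m := by
  rw [partialSum, partialSum, partialSum, List.map_cons, mpvPartial, mpvPartial]
  rcases Nat.eq_zero_or_pos m with rfl | hm
  · simp [hs.ne']
  · rw [Finset.sum_Ico_succ_top hm]

theorem partialSum_cons_zero (p : ℕ × ℕ) (t : List (ℕ × ℕ)) : partialSum (p :: t) 0 = 0 := by
  simp [partialSum, mpvPartial]

theorem coef_toWord_cons {s : ℕ} (hs : 0 < s) (e : ℕ) (t : List (ℕ × ℕ)) (m : ℕ) :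
    coef (toWord ((s, e) :: t)) m =
      (Complex.I ^ e) ^ m / (m : ℂ) ^ s * ∑ n ∈ Finset.range m, coef (toWord t) n := by
  rw [toWord, coef_replicate, coef_of_pos (normExp_pos e), root_normExp, div_div, ← pow_succ',
    Nat.sub_add_cancel hs, div_mul_eq_mul_div, Finset.mul_sum]
  congr 1
  refine Finset.sum_congr rfl fun n hn => ?_
  rw [coef_map_rotate, ← mul_assoc, ← pow_add, Nat.sub_add_cancel (Finset.mem_range.1 hn).le]

theorem partialSum_eq {l : List (ℕ × ℕ)} (hl : ∀ p ∈ l, 0 < p.1) {m : ℕ} (hm : 0 < m) :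
    partialSum l m = ∑ n ∈ Finset.range m, coef (toWord l) n := by
  induction l generalizing m with
  | nil => simp [partialSum, mpvPartial, toWord, coef, hm.ne']
  | cons p t ih =>
    obtain ⟨s, e⟩ := p
    rw [List.forall_mem_cons] at hl
    obtain ⟨m, rfl⟩ := Nat.exists_eq_succ_of_ne_zero hm.ne'
    clear hm
    induction m with
    | zero =>
      rw [Nat.succ_eq_add_one, zero_add, Finset.sum_range_one, coef_toWord_cons hl.1]
      simp [partialSum, mpvPartial]
    | succ m ihm =>
      rw [partialSum_cons_succ hl.1, ihm, Finset.sum_range_succ _ m.succ, coef_toWord_cons hl.1,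
        ih hl.2 m.succ_pos]

theorem tendsto_partialSum {l : List (ℕ × ℕ)} (hl : ∀ p ∈ l, 0 < p.1) (hc : Conv (toWord l)) :
    Tendsto (partialSum l) atTop (𝓝 (value (toWord l))) :=
  (tendsto_value hc).congr' (eventually_atTop.2 ⟨1, fun _ hm => (partialSum_eq hl hm).symm⟩)

theorem good_cons {a : ℕ} {w : List ℕ} (ha : a < 5) (h : 0 < a ∨ w ≠ []) (hw : Good w) :
    Good (a :: w) := by
  simpa [Good, and_assoc] using ⟨ha, h, hw⟩

theorem normExp_lt (e : ℕ) : normExp e < 5 := by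
  rw [normExp]
  omega

theorem Good.map_rotate {w : List ℕ} (hw : Good w) (e : ℕ) : Good (w.map (rotate e)) := by
  induction w with
  | nil => rfl
  | cons a w ih =>
    obtain ⟨-, h, hw⟩ := Good.cons hw
    refine good_cons ?_ ?_ (ih hw)
    · rw [rotate]
      split_ifs
      exacts [by norm_num, normExp_lt _]
    · refine h.imp (fun ha => ?_) (by simp)
      rw [rotate, if_neg ha.ne']
      exact normExp_pos _

theorem good_toWord (l : List (ℕ × ℕ)) : Good (toWord l) := by
  induction l with
  | nil => rfl
  | cons p t ih =>
    obtain ⟨s, e⟩ := p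
    rw [toWord]
    induction s - 1 with
    | zero => exact good_cons (normExp_lt e) (.inl (normExp_pos e)) (Good.map_rotate ih e)
    | succ n ih => exact good_cons (by norm_num) (.inr (by simp)) ih

theorem length_toWord {l : List (ℕ × ℕ)} (hl : ∀ p ∈ l, 0 < p.1) :
    (toWord l).length = (l.map Prod.fst).sum := by
  induction l with
  | nil => rfl
  | cons p t ih =>
    obtain ⟨s, e⟩ := p
    rw [List.forall_mem_cons] at hl
    have := hl.1
    simp [toWord, ih hl.2]
    omega

theorem conv_toWord {s e : ℕ} (t : List (ℕ × ℕ)) (h : s = 1 → Complex.I ^ e ≠ 1) (hs : 0 < s) :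
    Conv (toWord ((s, e) :: t)) := by
  rw [Conv, Bool.and_eq_true]
  refine ⟨?_, good_toWord _⟩
  rw [toWord]
  rcases Nat.eq_or_lt_of_le hs with h1 | h1
  · have he := h h1.symm
    rw [← h1]
    suffices normExp e ≠ 4 by simpa
    intro h4
    rw [← root_normExp, h4] at he
    exact he (by simp [root])
  · obtain ⟨n, hn⟩ : ∃ n, s - 1 = n + 1 := ⟨s - 2, by omega⟩
    simp [hn, List.replicate_succ]

theorem exists_eq_I_pow {z : ℂ} (hz : z ^ 4 = 1) : ∃ e : ℕ, z = Complex.I ^ e := by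
  have h : (z - 1) * (z + 1) * ((z - Complex.I) * (z + Complex.I)) = 0 := by
    linear_combination hz - (z ^ 2 - 1) * Complex.I_sq
  rcases mul_eq_zero.1 h with h | h <;> rcases mul_eq_zero.1 h with h | h
  · exact ⟨0, by linear_combination h⟩
  · exact ⟨2, by linear_combination h - Complex.I_sq⟩
  · exact ⟨1, by linear_combination h⟩
  · exact ⟨3, by linear_combination h - Complex.I * Complex.I_sq⟩

theorem exists_word_of_mem_MPVset {x : ℂ} {k : ℕ} (hx : x ∈ MPVset k 4) :
    ∃ w, Conv w ∧ w.length = k ∧ x = value w := by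
  obtain ⟨l, hl, hk, hhead, rfl⟩ := hx
  obtain ⟨l, rfl⟩ : ∃ l' : List (ℕ × ℕ), l = l'.map fun p => (p.1, Complex.I ^ p.2) := by
    clear hk hhead
    induction l with
    | nil => exact ⟨[], rfl⟩
    | cons p t ih =>
      obtain ⟨hp, ht⟩ := List.forall_mem_cons.1 hl
      obtain ⟨t, rfl⟩ := ih ht
      obtain ⟨e, he⟩ := exists_eq_I_pow hp.2
      exact ⟨(p.1, e) :: t, by rw [List.map_cons, ← he]⟩
  have hpos : ∀ p ∈ l, 0 < p.1 := fun p hp => (hl _ (List.mem_map_of_mem hp)).1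
  have hconv : Conv (toWord l) := by
    match l with
    | [] => rfl
    | (s, e) :: t =>
      refine conv_toWord t (fun hs he => hhead ?_) (hpos (s, e) (by simp))
      simp [hs, he]
  refine ⟨toWord l, hconv, ?_, (tendsto_partialSum hpos hconv).limUnder_eq⟩
  rw [length_toWord hpos, ← hk, List.map_map]
  rfl

theorem toIndex_pos {s : ℕ} (hs : 0 < s) (b : ℕ) (w : List ℕ) :
    ∀ p ∈ toIndex b s w, 0 < p.1 := by
  induction w generalizing s b with
  | nil => simp [toIndex]
  | cons a w ih =>
    cases a with
    | zero => exact ih s.succ_pos b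
    | succ a => exact List.forall_mem_cons.2 ⟨hs, ih Nat.one_pos _⟩

end Indices

section QuasiShuffle

variable {α : Type*} (mul : α → α → List α)

theorem quasiShuffle_nil (u : List α) : quasiShuffle mul u [] = [u] := by
  cases u <;> rfl

theorem quasiShuffle_cons_cons (a : α) (u : List α) (b : α) (v : List α) :
    quasiShuffle mul (a :: u) (b :: v) = (quasiShuffle mul u (b :: v)).map (a :: ·) ++
      (quasiShuffle mul (a :: u) v).map (b :: ·) ++
      (mul a b).flatMap fun c => (quasiShuffle mul u v).map (c :: ·) := rfl

theorem forall_quasiShuffle {P : α → Prop} (hmul : ∀ a b, P a → P b → ∀ c ∈ mul a b, P c)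
    {u v : List α} (hu : ∀ a ∈ u, P a) (hv : ∀ a ∈ v, P a) :
    ∀ w ∈ quasiShuffle mul u v, ∀ a ∈ w, P a := by
  induction u generalizing v with
  | nil => simpa [quasiShuffle] using hv
  | cons a u ihu =>
    induction v with
    | nil => simpa [quasiShuffle_nil] using hu
    | cons b v ihv =>
      have hu' := List.forall_mem_cons.1 hu
      have hv' := List.forall_mem_cons.1 hv
      intro w hw
      simp only [quasiShuffle_cons_cons, List.mem_append, List.mem_map, List.mem_flatMap] at hw
      obtain (⟨x, hx, rfl⟩ | ⟨x, hx, rfl⟩) | ⟨c, hc, x, hx, rfl⟩ := hw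
      · exact List.forall_mem_cons.2 ⟨hu'.1, ihu hu'.2 hv x hx⟩
      · exact List.forall_mem_cons.2 ⟨hv'.1, ihv hv'.2 x hx⟩
      · exact List.forall_mem_cons.2 ⟨hmul a b hu'.1 hv'.1 c hc, ihu hu'.2 hv'.2 x hx⟩

theorem pos_of_mem_stuffle {u v : List (ℕ × ℕ)} (hu : ∀ p ∈ u, 0 < p.1) (hv : ∀ p ∈ v, 0 < p.1) :
    ∀ w ∈ stuffle u v, ∀ p ∈ w, 0 < p.1 := by
  refine forall_quasiShuffle _ (fun p q hp hq c hc => ?_) hu hv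
  rw [List.mem_singleton.1 hc]
  exact Nat.add_pos_left hp _

theorem partialSum_mul_partialSum {u v : List (ℕ × ℕ)} (hu : ∀ p ∈ u, 0 < p.1)
    (hv : ∀ p ∈ v, 0 < p.1) (m : ℕ) :
    partialSum u m * partialSum v m = ((stuffle u v).map fun w => partialSum w m).sum := by
  induction u generalizing v m with
  | nil => simp [stuffle, quasiShuffle, partialSum, mpvPartial]
  | cons a u ihu =>
    induction v generalizing m with
    | nil => simp [stuffle, quasiShuffle_nil, partialSum, mpvPartial]
    | cons b v ihv =>
      have hu' := List.forall_mem_cons.1 hu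
      have hv' := List.forall_mem_cons.1 hv
      have hs : ∀ m, ((stuffle (a :: u) (b :: v)).map fun w => partialSum w m).sum =
          ((stuffle u (b :: v)).map fun w => partialSum (a :: w) m).sum +
          ((stuffle (a :: u) v).map fun w => partialSum (b :: w) m).sum +
          ((stuffle u v).map fun w => partialSum ((a.1 + b.1, a.2 + b.2) :: w) m).sum := by
        intro m
        simp [stuffle, quasiShuffle_cons_cons, Function.comp_def, add_assoc]
      induction m with
      | zero => simp [hs, partialSum_cons_zero]
      | succ m ihm =>
        rw [hs] at ihm ⊢
        simp only [partialSum_cons_succ hu'.1, partialSum_cons_succ hv'.1,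
          partialSum_cons_succ (Nat.add_pos_left hu'.1 b.1), List.sum_map_add, List.sum_map_mul_left]
        rw [← ihu hu'.2 hv m, ← ihu hu'.2 hv'.2 m, ← ihv hv'.2 m]
        rw [pow_add, pow_add, mul_pow, mul_div_mul_comm]
        linear_combination ihm

theorem value_mul_value_of_stuffle {p q : List (ℕ × ℕ)} (hp : ∀ x ∈ p, 0 < x.1)
    (hq : ∀ x ∈ q, 0 < x.1) (hp' : Conv (toWord p)) (hq' : Conv (toWord q))
    (h : ∀ x ∈ stuffle p q, Conv (toWord x)) :
    value (toWord p) * value (toWord q) =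
      ((stuffle p q).map fun x => value (toWord x)).sum := by
  refine tendsto_nhds_unique ((tendsto_partialSum hp hp').mul (tendsto_partialSum hq hq')) ?_
  simp only [partialSum_mul_partialSum hp hq]
  exact tendsto_list_sum _ fun x hx => tendsto_partialSum (pos_of_mem_stuffle hp hq x hx) (h x hx)

end QuasiShuffle

section IteratedIntegral

/-- The iterated integral of a word from `0` to `t`, for `|t| < 1`. -/
def integral (w : List ℕ) (t : ℝ) : ℂ := ∑' n, coef w n * (t : ℂ) ^ n

/-- The differential form of a letter. -/
def form (a : ℕ) (t : ℝ) : ℂ := if a = 0 then 1 / t else root a / (1 - root a * t)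

theorem exists_norm_coef_le_const (w : List ℕ) : ∃ C : ℝ, 0 ≤ C ∧ ∀ n, ‖coef w n‖ ≤ C := by
  obtain ⟨C, hC, h⟩ := exists_norm_coef_le w
  refine ⟨max 1 C, by positivity, fun n => ?_⟩
  rcases Nat.eq_zero_or_pos n with rfl | hn
  · exact (norm_coef_zero_le w).trans (le_max_left _ _)
  · refine ((h n hn).trans (div_le_self hC (Real.one_le_sqrt.2 ?_))).trans (le_max_right _ _)
    exact_mod_cast hn

theorem summable_coef_mul_pow (w : List ℕ) {t : ℝ} (ht : |t| < 1) :
    Summable fun n => coef w n * (t : ℂ) ^ n := by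
  obtain ⟨C, hC, h⟩ := exists_norm_coef_le_const w
  refine Summable.of_norm_bounded ((summable_geometric_of_abs_lt_one
    (r := |t|) (by rwa [abs_abs])).mul_left C) fun n => ?_
  rw [norm_mul, norm_pow, Complex.norm_real, Real.norm_eq_abs]
  gcongr
  exact h n

theorem summable_coef_mul_natCast_mul_pow (w : List ℕ) {t : ℝ} (ht : |t| < 1) :
    Summable fun n : ℕ => n * coef w n * (t : ℂ) ^ n := by
  obtain ⟨C, hC, h⟩ := exists_norm_coef_le_const w
  refine Summable.of_norm_bounded ((summable_pow_mul_geometric_of_norm_lt_one 1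
    (r := |t|) (by rwa [Real.norm_eq_abs, abs_abs])).mul_left C) fun n => ?_
  rw [norm_mul, norm_mul, norm_pow, Complex.norm_real, Real.norm_eq_abs, Complex.norm_natCast,
    pow_one, mul_comm (n : ℝ), mul_assoc]
  gcongr
  exact h n

theorem hasDerivAt_integral_tsum (w : List ℕ) {t : ℝ} (ht : |t| < 1) :
    HasDerivAt (integral w) (∑' n, coef w n * (n * (t : ℂ) ^ (n - 1))) t := by
  obtain ⟨C, hC, h⟩ := exists_norm_coef_le_const w
  obtain ⟨r, hr, hr1⟩ := exists_between ht
  have hr0 : 0 ≤ r := (abs_nonneg t).trans hr.le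
  refine HasDerivAt.comp_ofReal (e := fun z => ∑' n, coef w n * z ^ n)
    (hasDerivAt_tsum_of_isPreconnected (u := fun n : ℕ => C * (n * r ^ (n - 1)))
    (g' := fun n z => coef w n * (n * z ^ (n - 1))) ?_ Metric.isOpen_ball
    (convex_ball (0 : ℂ) r).isPreconnected (fun n y _ => (hasDerivAt_pow n y).const_mul _)
    (fun n y hy => ?_) (y₀ := t) ?_ (summable_coef_mul_pow w ht) ?_)
  · refine Summable.mul_left C ((summable_nat_add_iff 1).1 ?_)
    have h1 := (summable_pow_mul_geometric_of_norm_lt_one 1 (r := r)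
      (by rwa [Real.norm_eq_abs, abs_of_nonneg hr0])).add
      (summable_geometric_of_lt_one hr0 hr1)
    refine h1.congr fun n => ?_
    simp
    ring
  · rw [norm_mul, norm_mul, norm_pow, Complex.norm_natCast]
    rw [mem_ball_zero_iff] at hy
    gcongr
    exact h n
  · simpa using hr
  · simpa using hr

theorem one_sub_root_mul_ne_zero (a : ℕ) {t : ℝ} (ht : |t| < 1) : 1 - root a * t ≠ 0 := by
  refine sub_ne_zero.2 fun h => ?_
  have := congrArg norm h
  rw [norm_one, norm_mul, Complex.norm_real, Real.norm_eq_abs] at this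
  nlinarith [norm_root_le a, abs_nonneg t, norm_nonneg (root a)]

theorem integral_nil : integral [] = 1 := by
  ext t
  rw [integral, tsum_eq_single 0 fun n hn => by simp [coef, hn]]
  simp [coef]

theorem integral_cons_zero (a : ℕ) (w : List ℕ) : integral (a :: w) 0 = 0 := by
  rw [integral, tsum_eq_single 0 fun n hn => by simp [hn], coef_cons_zero, zero_mul]

theorem hasDerivAt_integral {a : ℕ} {w : List ℕ} (h : 0 < a ∨ w ≠ []) {t : ℝ}
    (ht : t ∈ Set.Ioo 0 1) : HasDerivAt (integral (a :: w)) (form a t * integral w t) t := by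
  have ht' : |t| < 1 := by rw [abs_of_pos ht.1]; exact ht.2
  have ht0 : (t : ℂ) ≠ 0 := Complex.ofReal_ne_zero.2 ht.1.ne'
  convert hasDerivAt_integral_tsum (a :: w) ht' using 1
  set D := ∑' n, coef (a :: w) n * (n * (t : ℂ) ^ (n - 1)) with hD
  have h1 : t * D = ∑' n : ℕ, n * coef (a :: w) n * (t : ℂ) ^ n := by
    rw [hD, ← tsum_mul_left]
    refine tsum_congr fun n => ?_
    cases n with
    | zero => simp
    | succ n =>
      rw [Nat.add_sub_cancel, pow_succ']
      ring
  cases a with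
  | zero =>
    have h2 : t * D = integral w t := by
      rw [h1, integral]
      refine tsum_congr fun n => ?_
      cases n with
      | zero =>
        cases w with
        | nil => simp at h
        | cons b w => simp [coef_cons_zero]
      | succ n => rw [coef, mul_div_cancel₀ _ (by exact_mod_cast n.succ_ne_zero)]
    rw [form, if_pos rfl, ← h2]
    field_simp
  | succ a =>
    have h2 : D = root (a + 1) * (t * D + integral w t) := by
      rw [h1, integral, ← (summable_coef_mul_natCast_mul_pow _ ht').tsum_add
        (summable_coef_mul_pow w ht'), ← tsum_mul_left]
      refine mul_left_cancel₀ ht0 ?_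
      rw [h1, (summable_coef_mul_natCast_mul_pow _ ht').tsum_eq_zero_add, ← tsum_mul_left]
      simp only [Nat.cast_zero, zero_mul, zero_add]
      refine tsum_congr fun n => ?_
      push_cast
      rw [coef_succ_mul, pow_succ]
      ring
    rw [form, if_neg a.succ_ne_zero, div_mul_eq_mul_div, div_eq_iff (one_sub_root_mul_ne_zero _ ht')]
    linear_combination -h2

theorem tendsto_integral_zero (a : ℕ) (w : List ℕ) :
    Tendsto (integral (a :: w)) (𝓝 0) (𝓝 0) := by
  rw [← integral_cons_zero a w]
  exact (hasDerivAt_integral_tsum _ (by simp)).continuousAt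

theorem isBigO_integral_zero (a : ℕ) (w : List ℕ) :
    integral (a :: w) =O[𝓝 0] fun t : ℝ => (t : ℂ) := by
  have := (hasDerivAt_integral_tsum (a :: w) (t := 0) (by simp)).isBigO_sub
  simp only [integral_cons_zero, sub_zero] at this
  exact this.trans (Asymptotics.isBigO_of_le _ fun t => by simp)

theorem tendsto_integral_one {w : List ℕ} (hw : Conv w) :
    Tendsto (integral w) (𝓝[<] 1) (𝓝 (value w)) :=
  tendsto_map'_iff.1 (Complex.tendsto_tsum_powerSeries_nhdsWithin_lt (tendsto_value hw))

theorem tendsto_one_sub_mul_integral (w : List ℕ) :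
    Tendsto (fun t : ℝ => (1 - t : ℂ) * integral w t) (𝓝[<] 1) (𝓝 0) := by
  set c : ℕ → ℂ := fun n => coef w n - if n = 0 then 0 else coef w (n - 1) with hc
  have hsum : ∀ m, ∑ n ∈ Finset.range (m + 1), c n = coef w m := fun m => by
    induction m with
    | zero => simp [hc]
    | succ m ih => rw [Finset.sum_range_succ, ih]; simp [hc]
  have h0 : Tendsto (fun m => ∑ n ∈ Finset.range m, c n) atTop (𝓝 0) := by
    rw [← tendsto_add_atTop_iff_nat 1]
    simp only [hsum]
    exact tendsto_coef w
  refine (tendsto_map'_iff.1 (Complex.tendsto_tsum_powerSeries_nhdsWithin_lt h0)).congr' ?_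
  filter_upwards [Ioo_mem_nhdsLT (show (0 : ℝ) < 1 by norm_num)] with t ht
  have ht' : |t| < 1 := by rw [abs_of_pos ht.1]; exact ht.2
  have hs := summable_coef_mul_pow w ht'
  have hshift : HasSum (fun n => (if n = 0 then 0 else coef w (n - 1)) * (t : ℂ) ^ n)
      (t * integral w t) := by
    rw [← hasSum_nat_add_iff' 1]
    simpa [integral, pow_succ', mul_left_comm] using hs.hasSum.mul_left (t : ℂ)
  rw [Function.comp_apply, sub_mul, one_mul]
  refine HasSum.tsum_eq ?_
  simpa only [hc, sub_mul, integral] using hs.hasSum.sub hshift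

theorem eq_of_hasDerivAt_zero {F : ℝ → ℂ} (hF : ∀ t ∈ Set.Ioo (0 : ℝ) 1, HasDerivAt F 0 t) {A : ℂ}
    (h0 : Tendsto F (𝓝[>] 0) (𝓝 A)) {t : ℝ} (ht : t ∈ Set.Ioo (0 : ℝ) 1) : F t = A := by
  refine (tendsto_nhds_unique h0 (tendsto_const_nhds.congr' ?_)).symm
  filter_upwards [Ioo_mem_nhdsGT (show (0 : ℝ) < 1 by norm_num)] with s hs
  exact isOpen_Ioo.is_const_of_deriv_eq_zero isPreconnected_Ioo
    (fun x hx => (hF x hx).differentiableAt.differentiableWithinAt) (fun x hx => (hF x hx).deriv)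
    ht hs

end IteratedIntegral

section Shuffle

theorem hasDerivAt_list_sum {ι : Type*} {l : List ι} {f : ι → ℝ → ℂ} {f' : ι → ℂ} {t : ℝ}
    (h : ∀ i ∈ l, HasDerivAt (f i) (f' i) t) :
    HasDerivAt (fun t => (l.map fun i => f i t).sum) (l.map f').sum t := by
  induction l with
  | nil => simpa using hasDerivAt_const t (0 : ℂ)
  | cons i l ih =>
    rw [List.forall_mem_cons] at h
    simp only [List.map_cons, List.sum_cons]
    exact h.1.add (ih h.2)

theorem integral_mul_integral {u v : List ℕ} (hu : Good u) (hv : Good v)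
    (h : ∀ w ∈ shuffle u v, Good w) {t : ℝ} (ht : t ∈ Set.Ioo (0 : ℝ) 1) :
    integral u t * integral v t = ((shuffle u v).map fun w => integral w t).sum := by
  induction u generalizing v t with
  | nil => simp [shuffle, quasiShuffle, integral_nil]
  | cons a u ihu =>
    induction v generalizing t with
    | nil => simp [shuffle, quasiShuffle_nil, integral_nil]
    | cons b v ihv =>
      have hs : shuffle (a :: u) (b :: v) =
          (shuffle u (b :: v)).map (a :: ·) ++ (shuffle (a :: u) v).map (b :: ·) := by
        simp [shuffle, quasiShuffle_cons_cons]
      obtain ⟨-, ha, hu'⟩ := Good.cons hu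
      obtain ⟨-, hb, hv'⟩ := Good.cons hv
      rw [hs, List.forall_mem_append, List.forall_mem_map, List.forall_mem_map] at h
      rw [hs, ← sub_eq_zero]
      simp only [List.map_append, List.map_map, Function.comp_def, List.sum_append]
      refine eq_of_hasDerivAt_zero (F := fun t => integral (a :: u) t * integral (b :: v) t -
        (((shuffle u (b :: v)).map fun w => integral (a :: w) t).sum +
          ((shuffle (a :: u) v).map fun w => integral (b :: w) t).sum)) (fun t ht => ?_) ?_ ht
      · have h1 := ihu hu' hv (fun w hw => (Good.cons (h.1 w hw)).2.2) ht
        have h2 := ihv hv' (fun w hw => (Good.cons (h.2 w hw)).2.2) ht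
        refine (((hasDerivAt_integral ha ht).mul (hasDerivAt_integral hb ht)).sub
          ((hasDerivAt_list_sum fun w hw =>
            hasDerivAt_integral (Good.cons (h.1 w hw)).2.1 ht).add
          (hasDerivAt_list_sum fun w hw =>
            hasDerivAt_integral (Good.cons (h.2 w hw)).2.1 ht))).congr_deriv ?_
        rw [List.sum_map_mul_left, List.sum_map_mul_left, ← h1, ← h2]
        ring
      · refine tendsto_nhdsWithin_of_tendsto_nhds ?_
        have hsum : ∀ (c : ℕ) (l : List (List ℕ)),
            Tendsto (fun t => (l.map fun w => integral (c :: w) t).sum) (𝓝 0) (𝓝 0) :=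
          fun c l => by
            simpa using tendsto_list_sum l fun w _ => tendsto_integral_zero c w
        simpa using ((tendsto_integral_zero a u).mul (tendsto_integral_zero b v)).sub
          ((hsum a _).add (hsum b _))

theorem value_mul_value_of_shuffle {u v : List ℕ} (hu : Conv u) (hv : Conv v)
    (h : ∀ w ∈ shuffle u v, Conv w) :
    value u * value v = ((shuffle u v).map value).sum := by
  refine tendsto_nhds_unique ((tendsto_integral_one hu).mul (tendsto_integral_one hv))
    ((tendsto_list_sum _ fun w hw => tendsto_integral_one (h w hw)).congr' ?_)
  filter_upwards [Ioo_mem_nhdsLT (show (0 : ℝ) < 1 by norm_num)] with t ht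
  exact (integral_mul_integral (Conv.good hu) (Conv.good hv) (fun w hw => Conv.good (h w hw))
    ht).symm

end Shuffle

section Duality

/-- The involution of the unit interval that permutes the differential forms of the letters. -/
def involution (t : ℝ) : ℝ := (1 - t) / (1 + t)

theorem involution_mem {t : ℝ} (ht : t ∈ Set.Ioo (0 : ℝ) 1) :
    involution t ∈ Set.Ioo (0 : ℝ) 1 := by
  obtain ⟨h0, h1⟩ := ht
  rw [involution, Set.mem_Ioo, lt_div_iff₀ (by linarith), div_lt_one (by linarith)]
  constructor <;> linarith

theorem hasDerivAt_involution {t : ℝ} (ht : t ∈ Set.Ioo (0 : ℝ) 1) :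
    HasDerivAt involution (-2 / (1 + t) ^ 2) t := by
  have h : 1 + t ≠ 0 := by linarith [ht.1]
  refine (((hasDerivAt_id t).const_sub 1).div ((hasDerivAt_id t).const_add 1) h).congr_deriv ?_
  simp only [id]
  ring

theorem sum_form_involution {a : ℕ} (ha : a < 5) {t : ℝ} (ht : t ∈ Set.Ioo (0 : ℝ) 1) :
    ((dualLetter a).map fun p => (p.1 : ℂ) * form p.2 (involution t)).sum *
      (-2 / (1 + t) ^ 2 : ℝ) = -form a t := by
  have hs := involution_mem ht
  have hs' : |involution t| < 1 := by rw [abs_of_pos hs.1]; exact hs.2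
  have ht' : |t| < 1 := by rw [abs_of_pos ht.1]; exact ht.2
  have h0 : (t : ℂ) ≠ 0 := Complex.ofReal_ne_zero.2 ht.1.ne'
  have h1 : (1 + t : ℂ) ≠ 0 := by
    exact_mod_cast (show 1 + t ≠ 0 by linarith [ht.1])
  have h2 : (1 - t : ℂ) ≠ 0 := by
    exact_mod_cast (show 1 - t ≠ 0 by linarith [ht.2])
  have hI := Complex.I_sq
  have hI3 : Complex.I ^ 3 = -Complex.I := by rw [pow_succ, hI]; ring
  have e1 := one_sub_root_mul_ne_zero 1 ht'
  have e3 := one_sub_root_mul_ne_zero 3 ht'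
  have f1 := one_sub_root_mul_ne_zero 1 hs'
  have f3 := one_sub_root_mul_ne_zero 3 hs'
  simp only [root, OfNat.ofNat_ne_zero, one_ne_zero, if_false, pow_one, hI3, neg_mul,
    sub_neg_eq_add] at e1 e3 f1 f3
  have hs2 : (involution t : ℂ) * (1 + t) = 1 - t := by
    rw [involution]
    push_cast
    exact div_mul_cancel₀ _ h1
  have hs0 : (involution t : ℂ) = (1 - t) / (1 + t) := by rw [← hs2, mul_div_cancel_right₀ _ h1]
  have g2 : 1 + (involution t : ℂ) = 2 / (1 + t) := by rw [hs0]; field_simp; ring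
  have g4 : 1 - (involution t : ℂ) = 2 * t / (1 + t) := by rw [hs0]; field_simp; ring
  have g3 : Complex.I / (1 + Complex.I * involution t) =
      (1 + Complex.I) * (1 + t) / (2 * (1 - Complex.I * t)) := by
    rw [div_eq_div_iff f3 (mul_ne_zero two_ne_zero e1)]
    linear_combination (-Complex.I ^ 2 - Complex.I) * hs2 + (-(1 - t) - 2 * t) * hI
  have g1 : Complex.I / (1 - Complex.I * involution t) =
      (Complex.I - 1) * (1 + t) / (2 * (1 + Complex.I * t)) := by
    rw [div_eq_div_iff f1 (mul_ne_zero two_ne_zero e3)]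
    linear_combination (Complex.I ^ 2 - Complex.I) * hs2 + ((1 - t) + 2 * t) * hI
  generalize hd1 : 1 - Complex.I * (t : ℂ) = d1 at *
  generalize hd3 : 1 + Complex.I * (t : ℂ) = d3 at *
  interval_cases a <;>
    simp [dualLetter, form, root, hI3, neg_div, g1, g2, g3, g4, hd1, hd3] <;>
    (try rw [hs0]) <;> field_simp
  · linear_combination hd1
  · linear_combination -hd3
  · ring

theorem tendsto_involution_zero : Tendsto involution (𝓝[>] 0) (𝓝[<] 1) := by
  refine tendsto_nhdsWithin_iff.2 ⟨?_, ?_⟩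
  · have : ContinuousAt involution 0 :=
      (continuousAt_const.sub continuousAt_id).div (continuousAt_const.add continuousAt_id) (by simp)
    simpa [involution] using this.tendsto.mono_left nhdsWithin_le_nhds
  · filter_upwards [Ioo_mem_nhdsGT (show (0 : ℝ) < 1 by norm_num)] with t ht
    exact (involution_mem ht).2

theorem tendsto_involution_one : Tendsto involution (𝓝[<] 1) (𝓝 0) := by
  have : ContinuousAt involution 1 :=
    (continuousAt_const.sub continuousAt_id).div (continuousAt_const.add continuousAt_id)
      (by norm_num)
  simpa [involution] using this.tendsto.mono_left nhdsWithin_le_nhds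

/-- The combination of iterated integrals obtained from those from `t` to `1` by the substitution
`involution`. -/
def dualIntegral (r : List ℕ) (t : ℝ) : ℂ :=
  ((dualTerms r).map fun q => (q.1 : ℂ) * integral q.2 (involution t)).sum

theorem dualIntegral_nil : dualIntegral [] = 1 := by
  ext t
  simp [dualIntegral, dualTerms, integral_nil]

theorem good_of_cons {a : ℕ} (ha : a < 5) {r : List ℕ} (h : ∀ q ∈ dualTerms (a :: r), Good q.2) :
    ∀ q ∈ dualTerms r, Good q.2 := by
  obtain ⟨p, hp⟩ : ∃ p, p ∈ dualLetter a := by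
    interval_cases a <;> exact ⟨_, List.mem_cons_self⟩
  intro q hq
  exact (Good.cons (h (p.1 * q.1, p.2 :: q.2)
    (List.mem_flatMap.2 ⟨p, hp, List.mem_map.2 ⟨q, hq, rfl⟩⟩))).2.2

theorem hasDerivAt_dualIntegral {a : ℕ} (ha : a < 5) {r : List ℕ}
    (h : ∀ q ∈ dualTerms (a :: r), Good q.2) {t : ℝ} (ht : t ∈ Set.Ioo (0 : ℝ) 1) :
    HasDerivAt (dualIntegral (a :: r)) (-form a t * dualIntegral r t) t := by
  have hs := involution_mem ht
  refine (hasDerivAt_list_sum fun q hq => HasDerivAt.const_mul (q.1 : ℂ)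
    (d' := (-2 / (1 + t) ^ 2 : ℝ) • ((match q.2 with
      | [] => 0
      | b :: w => form b (involution t) * integral w (involution t)) : ℂ)) ?_).congr_deriv ?_
  · have hg := h q hq
    obtain ⟨p, -, hq⟩ := List.mem_flatMap.1 hq
    obtain ⟨q, -, rfl⟩ := List.mem_map.1 hq
    exact (hasDerivAt_integral (Good.cons hg).2.1 hs).scomp t (hasDerivAt_involution ht)
  · rw [← sum_form_involution ha ht, dualIntegral, dualTerms]
    induction dualLetter a with
    | nil => simp
    | cons p l ih =>
      rw [List.flatMap_cons, List.map_append, List.sum_append, ih, List.map_cons, List.sum_cons,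
        add_mul, add_mul, add_left_inj, List.map_map, ← List.sum_map_mul_left]
      refine congrArg List.sum (List.map_congr_left fun q _ => ?_)
      simp only [Function.comp_apply, Complex.real_smul]
      push_cast
      ring

/-- The sum over the splittings of the word `r.reverse ++ v` at a place in `v` of the products of
the iterated integral from `0` to `t` of the second part and from `t` to `1` of the first. -/
def splitSum (t : ℝ) : List ℕ → List ℕ → ℂ
  | r, [] => dualIntegral r t
  | r, a :: v => dualIntegral r t * integral (a :: v) t + splitSum t (a :: r) v

theorem lt_of_mem_of_good {w : List ℕ} (hw : Good w) : ∀ a ∈ w, a < 5 := by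
  induction w with
  | nil => simp
  | cons a w ih => exact List.forall_mem_cons.2 ⟨(Good.cons hw).1, ih (Good.cons hw).2.2⟩

theorem hasDerivAt_splitSum {t : ℝ} (ht : t ∈ Set.Ioo (0 : ℝ) 1) {v : List ℕ} (hv : Good v)
    {r : List ℕ} (h : ∀ q ∈ dualTerms (v.reverse ++ r), Good q.2) {d : ℂ}
    (hd : HasDerivAt (dualIntegral r) d t) :
    HasDerivAt (fun t => splitSum t r v) (d * integral v t) t := by
  induction v generalizing r d with
  | nil => simpa [splitSum, integral_nil] using hd
  | cons a v ih =>
    obtain ⟨ha, ha', hv'⟩ := Good.cons hv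
    rw [List.reverse_cons, List.append_assoc, List.singleton_append] at h
    have hgood : ∀ l : List ℕ, (∀ b ∈ l, b < 5) → (∀ q ∈ dualTerms (l ++ a :: r), Good q.2) →
        ∀ q ∈ dualTerms (a :: r), Good q.2 := fun l hl h => by
      induction l with
      | nil => exact h
      | cons b l ih =>
        rw [List.forall_mem_cons] at hl
        exact ih hl.2 (good_of_cons hl.1 h)
    have h1 := hasDerivAt_dualIntegral ha (hgood _ (fun b hb => lt_of_mem_of_good hv' b
      (List.mem_reverse.1 hb)) h) ht
    refine ((hd.mul (hasDerivAt_integral ha' ht)).add (ih hv' h h1)).congr_deriv ?_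
    ring

theorem tendsto_mul_integral_one {f : ℝ → ℂ}
    (hf : f =O[𝓝[<] 1] fun t : ℝ => (1 - t : ℂ)) (w : List ℕ) :
    Tendsto (fun t => f t * integral w t) (𝓝[<] 1) (𝓝 0) := by
  have := (hf.mul (Asymptotics.isBigO_refl (integral w) _)).trans_tendsto
    (tendsto_one_sub_mul_integral w)
  exact this

theorem isBigO_dualIntegral (a : ℕ) (r : List ℕ) :
    dualIntegral (a :: r) =O[𝓝[<] 1] fun t : ℝ => (1 - t : ℂ) := by
  have hi : ∀ (b : ℕ) (w : List ℕ),
      (fun t => integral (b :: w) (involution t)) =O[𝓝[<] 1] fun t : ℝ => (1 - t : ℂ) := by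
    intro b w
    refine ((isBigO_integral_zero b w).comp_tendsto tendsto_involution_one).trans ?_
    refine Asymptotics.IsBigO.of_bound 1 ?_
    filter_upwards [Ioo_mem_nhdsLT (show (0 : ℝ) < 1 by norm_num)] with t ht
    rw [Function.comp_apply, one_mul, ← Complex.ofReal_one, ← Complex.ofReal_sub,
      Complex.norm_real, Complex.norm_real, involution, norm_div]
    refine div_le_self (norm_nonneg _) ?_
    rw [Real.norm_eq_abs]
    exact (by linarith [ht.1] : 1 ≤ 1 + t).trans (le_abs_self _)
  have hl : ∀ l : List (ℤ × List ℕ), (∀ q ∈ l, ∃ b w, q.2 = b :: w) →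
      (fun t => (l.map fun q => (q.1 : ℂ) * integral q.2 (involution t)).sum) =O[𝓝[<] 1]
        fun t : ℝ => (1 - t : ℂ) := fun l hl => by
    induction l with
    | nil => simpa using Asymptotics.isBigO_zero _ _
    | cons q l ih =>
      rw [List.forall_mem_cons] at hl
      obtain ⟨b, w, hq⟩ := hl.1
      simp only [List.map_cons, List.sum_cons, hq]
      exact ((hi b w).const_mul_left _).add (ih hl.2)
  refine hl _ fun q hq => ?_
  obtain ⟨p, -, hq⟩ := List.mem_flatMap.1 hq
  obtain ⟨q, -, rfl⟩ := List.mem_map.1 hq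
  exact ⟨_, _, rfl⟩

theorem tendsto_splitSum_one (a : ℕ) (r v : List ℕ) :
    Tendsto (fun t => splitSum t (a :: r) v) (𝓝[<] 1) (𝓝 0) := by
  induction v generalizing a r with
  | nil =>
    refine (isBigO_dualIntegral a r).trans_tendsto (tendsto_nhdsWithin_of_tendsto_nhds ?_)
    have : ContinuousAt (fun t : ℝ => (1 - t : ℂ)) 1 := by fun_prop
    simpa using this.tendsto
  | cons b v ih =>
    simpa [splitSum] using
      (tendsto_mul_integral_one (isBigO_dualIntegral a r) (b :: v)).add (ih b (a :: r))

theorem tendsto_dualIntegral_mul_integral_zero (r : List ℕ) (a : ℕ) (v : List ℕ) :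
    Tendsto (fun t => dualIntegral r t * integral (a :: v) t) (𝓝[>] 0) (𝓝 0) := by
  have hi : ∀ w : List ℕ, Tendsto (fun t : ℝ => integral w (involution t) * t) (𝓝[>] 0) (𝓝 0) := by
    intro w
    have h1 : ContinuousAt (fun t : ℝ => (1 + t : ℂ) / 2) 0 := by fun_prop
    have h2 := (h1.tendsto.mono_left nhdsWithin_le_nhds).mul
      ((tendsto_one_sub_mul_integral w).comp tendsto_involution_zero)
    rw [mul_zero] at h2
    refine h2.congr' ?_
    filter_upwards [Ioo_mem_nhdsGT (show (0 : ℝ) < 1 by norm_num)] with t ht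
    have h3 : (1 + t : ℂ) ≠ 0 := by
      exact_mod_cast (show 1 + t ≠ 0 by linarith [ht.1])
    have h4 : (involution t : ℂ) * (1 + t) = 1 - t := by
      rw [involution]
      push_cast
      exact div_mul_cancel₀ _ h3
    rw [Function.comp_apply]
    linear_combination (-integral w (involution t) / 2) * h4
  have h : Tendsto (fun t : ℝ => dualIntegral r t * t) (𝓝[>] 0) (𝓝 0) := by
    have := tendsto_list_sum (dualTerms r) fun q _ => (hi q.2).const_mul (q.1 : ℂ)
    simpa [dualIntegral, ← mul_assoc, List.sum_map_mul_right] using this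
  exact ((Asymptotics.isBigO_refl (dualIntegral r) _).mul
    ((isBigO_integral_zero a v).mono nhdsWithin_le_nhds)).trans_tendsto h

theorem tendsto_splitSum_zero (r v : List ℕ) (h : ∀ q ∈ dualTerms (v.reverse ++ r), Conv q.2) :
    Tendsto (fun t => splitSum t r v) (𝓝[>] 0)
      (𝓝 ((dualTerms (v.reverse ++ r)).map fun q => (q.1 : ℂ) * value q.2).sum) := by
  induction v generalizing r with
  | nil =>
    exact tendsto_list_sum _ fun q hq =>
      ((tendsto_integral_one (h q hq)).comp tendsto_involution_zero).const_mul _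
  | cons a v ih =>
    rw [List.reverse_cons, List.append_assoc, List.singleton_append] at h ⊢
    simpa [splitSum] using (tendsto_dualIntegral_mul_integral_zero r a v).add (ih (a :: r) h)

theorem value_eq_sum_dualTerms {w : List ℕ} (hw : Conv w)
    (h : ∀ q ∈ dualTerms w.reverse, Conv q.2) :
    value w = ((dualTerms w.reverse).map fun q => (q.1 : ℂ) * value q.2).sum := by
  cases w with
  | nil => simp [dualTerms]
  | cons a v =>
    have h0 := tendsto_splitSum_zero [] (a :: v) (by rwa [List.append_nil])
    rw [List.append_nil] at h0
    have h1 : Tendsto (fun t => splitSum t [] (a :: v)) (𝓝[<] 1) (𝓝 (value (a :: v))) := by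
      simpa [splitSum, dualIntegral_nil] using
        (tendsto_integral_one hw).add (tendsto_splitSum_one a [] v)
    refine tendsto_nhds_unique h1 (tendsto_const_nhds.congr' ?_)
    filter_upwards [Ioo_mem_nhdsLT (show (0 : ℝ) < 1 by norm_num)] with t ht
    refine (eq_of_hasDerivAt_zero (fun s hs => ?_) h0 ht).symm
    have hd : HasDerivAt (dualIntegral []) 0 s := by
      rw [dualIntegral_nil]
      exact hasDerivAt_const s 1
    simpa using hasDerivAt_splitSum hs (Conv.good hw) (r := [])
      (fun q hq => Conv.good (h q (by rwa [List.append_nil] at hq))) hd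

end Duality

section Relations

theorem coef_singleton {a : ℕ} (ha : 0 < a) (n : ℕ) : coef [a] n = root a ^ n / n := by
  rw [coef_of_pos ha]
  rcases Nat.eq_zero_or_pos n with rfl | hn
  · simp
  · simp [coef, hn]

theorem value_distribution {u v w : List ℕ} (hu : Conv u) (hv : Conv v) (hw : Conv w) (c : ℂ)
    (heven : ∀ k, c * (coef u (2 * k) + coef v (2 * k)) = coef w k)
    (hodd : ∀ k, coef u (2 * k + 1) + coef v (2 * k + 1) = 0) :
    c * (value u + value v) = value w := by
  have h2 : Tendsto (fun m : ℕ => 2 * m) atTop atTop :=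
    tendsto_id.const_mul_atTop' two_pos
  refine tendsto_nhds_unique
    ((((tendsto_value hu).comp h2).add ((tendsto_value hv).comp h2)).const_mul c)
    ((tendsto_value hw).congr fun m => ?_)
  simp only [Function.comp_apply]
  induction m with
  | zero => simp
  | succ m ih =>
    rw [Finset.sum_range_succ, ih, mul_add_one, Finset.sum_range_succ, Finset.sum_range_succ,
      Finset.sum_range_succ, Finset.sum_range_succ]
    linear_combination -heven m - c * hodd m

theorem coef_one (n : ℕ) : coef [1] n = Complex.I ^ n / n := by
  rw [coef_singleton one_pos, root, if_neg one_ne_zero, pow_one]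

theorem coef_two (n : ℕ) : coef [2] n = (-1) ^ n / n := by
  rw [coef_singleton two_pos, root, if_neg two_ne_zero, Complex.I_sq]

theorem coef_three (n : ℕ) : coef [3] n = (-Complex.I) ^ n / n := by
  rw [coef_singleton three_pos, root, if_neg three_ne_zero, Complex.I_pow_three]

theorem coef_even (k : ℕ) : coef [1] (2 * k) + coef [3] (2 * k) = coef [2] k := by
  rw [coef_one, coef_two, coef_three, pow_mul, pow_mul, neg_sq, Complex.I_sq]
  push_cast
  field_simp
  ring

theorem coef_odd (k : ℕ) : coef [1] (2 * k + 1) + coef [3] (2 * k + 1) = 0 := by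
  rw [coef_one, coef_three, pow_succ, pow_succ, pow_mul, pow_mul, neg_sq]
  ring

theorem value_one_add_value_three : value [1] + value [3] = value [2] := by
  simpa using value_distribution (u := [1]) (v := [3]) (w := [2]) rfl rfl rfl 1
    (fun k => by rw [one_mul, coef_even]) coef_odd

theorem value_zero_one_add_value_zero_three :
    2 * (value [0, 1] + value [0, 3]) = value [0, 2] := by
  refine value_distribution rfl rfl rfl 2 (fun k => ?_) fun k => ?_
  · rw [coef.eq_2, coef.eq_2, coef.eq_2, ← coef_even]
    push_cast
    field_simp
  · rw [coef.eq_2, coef.eq_2, ← add_div, coef_odd, zero_div]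

theorem sum_shuffleTerms {l : List (ℤ × List ℕ)} (hl : ∀ q ∈ l, Conv q.2) {w : List ℕ}
    (hw : Conv w) (h : ∀ q ∈ shuffleTerms l w, Conv q.2) :
    ((shuffleTerms l w).map fun q => q.1 • value q.2).sum =
      (l.map fun q => q.1 • value q.2).sum * value w := by
  induction l with
  | nil => simp [shuffleTerms]
  | cons q l ih =>
    rw [List.forall_mem_cons] at hl
    have hs : shuffleTerms (q :: l) w =
      (shuffle q.2 w).map (fun v => (q.1, v)) ++ shuffleTerms l w := rfl
    rw [hs, List.forall_mem_append, List.forall_mem_map] at h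
    rw [hs, List.map_append, List.sum_append, ih hl.2 h.2, List.map_cons, List.sum_cons, add_mul,
      smul_mul_assoc, value_mul_value_of_shuffle hl.1 hw h.1, List.map_map]
    simp only [zsmul_eq_mul, ← List.sum_map_mul_left]
    rfl

theorem sum_map_neg {ι : Type*} (l : List ι) (f : ι → ℂ) :
    (l.map fun x => -f x).sum = -(l.map f).sum := by
  rw [← neg_one_mul, ← List.sum_map_mul_left]
  simp only [neg_one_mul]

theorem sum_terms_eq_zero (u v : ℕ) (h : ∀ q ∈ terms u v, Conv q.2) :
    ((terms u v).map fun q => q.1 • value q.2).sum = 0 := by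
  unfold terms at h ⊢
  generalize dec 5 v [] = w at h ⊢
  dsimp only at h ⊢
  split at h <;> try dsimp only at h ⊢
  · rw [List.forall_mem_cons, List.forall_mem_map] at h
    rw [List.map_cons, List.sum_cons, List.map_map, one_smul, value_eq_sum_dualTerms h.1 h.2]
    simp [Function.comp_def, sum_map_neg]
  · cases hw : Conv w with
    | false => simp
    | true =>
      rw [hw, cond_true] at h
      rw [cond_true, sum_shuffleTerms (by decide) hw h]
      simp [← value_one_add_value_three]
  · cases hw : Conv w with
    | false => simp
    | true =>
      rw [hw, cond_true] at h
      rw [cond_true, sum_shuffleTerms (by decide) hw h]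
      simp [← value_zero_one_add_value_zero_three, mul_add]
  · generalize hp : toIndex 0 1 (dec 5 u []) = p at h ⊢
    generalize hq : toIndex 0 1 w = q at h ⊢
    cases hpq : Conv (toWord p) && Conv (toWord q) with
    | false => simp
    | true =>
      rw [hpq, cond_true] at h
      rw [Bool.and_eq_true] at hpq
      rw [List.forall_mem_append, List.forall_mem_map, List.forall_mem_map] at h
      have h1 := value_mul_value_of_shuffle hpq.1 hpq.2 h.1
      rw [value_mul_value_of_stuffle (hp ▸ toIndex_pos one_pos _ _) (hq ▸ toIndex_pos one_pos _ _)
        hpq.1 hpq.2 h.2] at h1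
      simp [Function.comp_def, sum_map_neg, h1]

end Relations

end

end Polylog

/-- the `ℚ`-vector space spanned by all multiple polylogarithm
values of weight 4 and level 4 has dimension at most 16, i.e. `d(4,4) ≤ 16`. -/
theorem mpv_dim_weight4_level4 :
    Module.rank ℚ ↥(MPV 4 4) ≤ 16 := by
  have hle : MPV 4 4 ≤ Submodule.span ℚ (Set.range fun i : Fin 16 =>
      Polylog.value (Polylog.dec 5 (Polylog.basisCodes.get i) [])) := by
    refine Submodule.span_le.2 fun x hx => ?_
    obtain ⟨w, hw, hlen, rfl⟩ := Polylog.exists_word_of_mem_MPVset hx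
    exact Polylog.mem_span_of_relations Polylog.value Polylog.sum_terms_eq_zero hw hlen
  refine (Submodule.rank_mono hle).trans ((rank_span_le _).trans ?_)
  simpa using Cardinal.mk_range_le (f := fun i : Fin 16 =>
    Polylog.value (Polylog.dec 5 (Polylog.basisCodes.get i) []))
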